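/- arXiv:2311.13872 — 3 statements merged into one kernel-verified Lean document; each statement's English description precedes it below -/
import Mathlib

section
/- Let μ, ν ∈ M₊(X) with μ(X) = ν(X). Then F(μ,ν) = sup { ∫_X ψ dν − ∫_X ψ dμ : ψ ∈ C²_c(ℝ^d) with ½∇²ψ(x) ∈ dom(f*) for all x ∈ X }, where dom(f*) = { A ∈ M_d : A:M ≤ f(M) for all M ∈ dom(f) }. -/
open MeasureTheory Set Filter Topology
open scoped ENNReal NNReal Classical

noncomputable section

/-- Euclidean space `ℝ^d`. -/
abbrev Ed (d : ℕ) := EuclideanSpace ℝ (Fin d)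

/-- The space `M_d` of real `d × d` matrices. -/
abbrev Matd (d : ℕ) := Matrix (Fin d) (Fin d) ℝ

/-- The Frobenius inner product `A : B = tr(Aᵀ B)`. -/
def frob {d : ℕ} (A B : Matd d) : ℝ := ∑ i, ∑ j, A i j * B i j

/-- The Frobenius norm of a matrix. -/
def matnorm {d : ℕ} (A : Matd d) : ℝ := Real.sqrt (frob A A)

/-- The Hessian matrix `∇²φ(x)`. -/
def hess {d : ℕ} (φ : Ed d → ℝ) (x : Ed d) : Matd d :=
  fun i j => iteratedFDeriv ℝ 2 φ x ![EuclideanSpace.single i 1, EuclideanSpace.single j 1]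

/-- `φ ∈ C²_c(ℝ^d)`. -/
def IsC2c {d : ℕ} (φ : Ed d → ℝ) : Prop := ContDiff ℝ 2 φ ∧ HasCompactSupport φ

/-- Assumption (A1): `dom f ⊆ S⁺_d`, `f` is coercive and sublinear
(subadditive and positively 1-homogeneous). -/
def CostA1 {d : ℕ} (f : Matd d → ℝ≥0∞) : Prop :=
  (∀ M, f M ≠ ⊤ → M.PosSemidef) ∧
  (∃ c : ℝ, 0 < c ∧ ∀ M, ENNReal.ofReal (c * matnorm M) ≤ f M) ∧
  (∀ A B, f (A + B) ≤ f A + f B) ∧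
  (∀ t : ℝ, 0 ≤ t → ∀ A, f (t • A) = ENNReal.ofReal t * f A)

/-- Assumption (A2): `f` is lower semicontinuous. -/
def CostA2 {d : ℕ} (f : Matd d → ℝ≥0∞) : Prop := LowerSemicontinuous f

/-- `dom(f⋆) = {A | A : M ≤ f(M) for all M ∈ dom f}`. -/
def domFstar {d : ℕ} (f : Matd d → ℝ≥0∞) : Set (Matd d) :=
  { A | ∀ M, f M ≠ ⊤ → ENNReal.ofReal (frob A M) ≤ f M }

/-- A competitor `λ = ρ·m` (an `S⁺_d`-valued measure supported in `X`) for the static problem: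
`tr(½∇²λ) = ν − μ` in the distributional sense. -/
def IsStaticCompetitor {d : ℕ} (X : Set (Ed d)) (μ ν : Measure (Ed d))
    (m : Measure (Ed d)) (ρ : Ed d → Matd d) : Prop :=
  IsFiniteMeasure m ∧ m Xᶜ = 0 ∧ (∀ x, (ρ x).PosSemidef) ∧
    ∀ φ : Ed d → ℝ, IsC2c φ →
      ∫ x, (1/2 : ℝ) * frob (hess φ x) (ρ x) ∂m = ∫ x, φ x ∂ν - ∫ x, φ x ∂μ

/-- The static value `F(μ,ν)` (using the positive 1-homogeneity of `f`, the cost of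
`λ = ρ·m` is `∫ f(dλ/d|λ|) d|λ| = ∫ f(ρ) dm`). -/
def Fstat {d : ℕ} (f : Matd d → ℝ≥0∞) (X : Set (Ed d)) (μ ν : Measure (Ed d)) : ℝ≥0∞ :=
  sInf { c | ∃ m ρ, IsStaticCompetitor X μ ν m ρ ∧ c = ∫⁻ x, f (ρ x) ∂m }

/-- `(ϱ, λ)`, with `ϱ = ϱ_t ⊗ L¹⌞(0,1)` and `λ = (ρ_t · m_t) ⊗ L¹⌞(0,1)` an `S⁺_d`-valued
measure, solves the Fokker–Planck equation `∂_t ϱ = tr(½∇²λ)` on `(0,1) × ℝ^d`. -/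
def SolvesFPE {d : ℕ} (ϱ : ℝ → Measure (Ed d)) (m : ℝ → Measure (Ed d))
    (ρ : ℝ → Ed d → Matd d) : Prop :=
  (∀ t ∈ Ioo (0:ℝ) 1, IsFiniteMeasure (ϱ t) ∧ IsFiniteMeasure (m t)) ∧
  (∀ t ∈ Ioo (0:ℝ) 1, ∀ x, (ρ t x).PosSemidef) ∧
  (∀ A : Set (Ed d), IsCompact A →
    (∫⁻ t in Ioo (0:ℝ) 1, ∫⁻ x in A, ENNReal.ofReal (matnorm (ρ t x)) ∂(m t)) < ⊤) ∧
  (∀ φ : ℝ × Ed d → ℝ, ContDiff ℝ 2 φ → HasCompactSupport φ →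
    tsupport φ ⊆ Ioo (0:ℝ) 1 ×ˢ (univ : Set (Ed d)) →
    (∫ t in Ioo (0:ℝ) 1, ∫ x, fderiv ℝ φ (t, x) (1, 0) ∂(ϱ t)) =
      - ∫ t in Ioo (0:ℝ) 1, ∫ x, (1/2 : ℝ) * frob (hess (fun y => φ (t, y)) x) (ρ t x) ∂(m t))

/-- The support condition (⋆): `supp ϱ_t, supp λ_t ⊆ X` for a.e. `t ∈ (0,1)`. -/
def SuppCond {d : ℕ} (X : Set (Ed d)) (ϱ m : ℝ → Measure (Ed d)) : Prop :=
  ∀ᵐ t ∂(volume.restrict (Ioo (0:ℝ) 1)), (ϱ t) Xᶜ = 0 ∧ (m t) Xᶜ = 0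

/-- `μ` is the weak* (narrow) limit of `ϱ_t` as `t → t₀` within `(0,1)`. -/
def NarrowLim {d : ℕ} (ϱ : ℝ → Measure (Ed d)) (t₀ : ℝ) (μ : Measure (Ed d)) : Prop :=
  ∀ g : BoundedContinuousFunction (Ed d) ℝ,
    Tendsto (fun t => ∫ x, g x ∂(ϱ t)) (𝓝[Ioo (0:ℝ) 1] t₀) (𝓝 (∫ x, g x ∂μ))

/-- The dynamic (Benamou–Brenier type) value `F(μ,ν)`. -/
def Fdyn {d : ℕ} (f : Matd d → ℝ≥0∞) (X : Set (Ed d)) (μ ν : Measure (Ed d)) : ℝ≥0∞ :=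
  sInf { c | ∃ ϱ m ρ, SolvesFPE ϱ m ρ ∧ SuppCond X ϱ m ∧
      NarrowLim ϱ 0 μ ∧ NarrowLim ϱ 1 ν ∧
      c = ∫⁻ t in Ioo (0:ℝ) 1, ∫⁻ x, f (ρ t x) ∂(m t) }

/-- the cost `G(x,p) := F(δ_x, p)`. -/
def Gcost {d : ℕ} (f : Matd d → ℝ≥0∞) (X : Set (Ed d)) (x : Ed d)
    (p : Measure (Ed d)) : ℝ≥0∞ :=
  Fstat f X (Measure.dirac x) p

/-- A disintegration kernel `x ↦ γ^x` of a transport plan `γ ∈ Π(μ,ν)`. -/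
def IsTransportKernel {d : ℕ} (X : Set (Ed d)) (μ ν : Measure (Ed d))
    (κ : Ed d → Measure (Ed d)) : Prop :=
  (∀ x, IsProbabilityMeasure (κ x) ∧ (κ x) Xᶜ = 0) ∧
  (∀ A : Set (Ed d), MeasurableSet A → Measurable fun x => κ x A) ∧
  (∀ A : Set (Ed d), MeasurableSet A → ∫⁻ x, κ x A ∂μ = ν A)

/-- The static optimal transport value `H(μ,ν) = inf_{γ ∈ Π(μ,ν)} ∫ G(x,γ^x) dμ`. -/
def Hcost {d : ℕ} (f : Matd d → ℝ≥0∞) (X : Set (Ed d)) (μ ν : Measure (Ed d)) : ℝ≥0∞ :=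
  sInf { c | ∃ κ, IsTransportKernel X μ ν κ ∧ c = ∫⁻ x, Gcost f X x (κ x) ∂μ }

/-- Integral of `φ` against a signed measure. -/
def sInt {d : ℕ} (s : SignedMeasure (Ed d)) (φ : Ed d → ℝ) : ℝ :=
  ∫ x, φ x ∂s.toJordanDecomposition.posPart - ∫ x, φ x ∂s.toJordanDecomposition.negPart

/-- A signed measure is supported in `X`. -/
def SuppInX {d : ℕ} (X : Set (Ed d)) (s : SignedMeasure (Ed d)) : Prop :=
  ∀ A : Set (Ed d), MeasurableSet A → A ⊆ Xᶜ → s A = 0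

/-- The extension of `F` to signed measures: `+∞` unless `μ, ν ≥ 0` with equal masses. -/
def FSgn {d : ℕ} (f : Matd d → ℝ≥0∞) (X : Set (Ed d)) (μ ν : SignedMeasure (Ed d)) : ℝ≥0∞ :=
  if 0 ≤ μ ∧ 0 ≤ ν ∧ μ univ = ν univ then
    Fstat f X μ.toJordanDecomposition.posPart ν.toJordanDecomposition.posPart
  else ⊤

/-- The extension of `H` to signed measures: `+∞` unless `μ, ν ≥ 0` with equal masses. -/
def HSgn {d : ℕ} (f : Matd d → ℝ≥0∞) (X : Set (Ed d)) (μ ν : SignedMeasure (Ed d)) : ℝ≥0∞ :=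
  if 0 ≤ μ ∧ 0 ≤ ν ∧ μ univ = ν univ then
    Hcost f X μ.toJordanDecomposition.posPart ν.toJordanDecomposition.posPart
  else ⊤

/-- The weak* topology on signed measures, in duality with continuous functions. -/
def weakStarTop (d : ℕ) : TopologicalSpace (SignedMeasure (Ed d)) :=
  ⨅ g : C(Ed d, ℝ), TopologicalSpace.induced (fun s => sInt s g) inferInstance

/-- The `G`-transform `φ^G(x) = inf { ∫ φ dp + G(x,p) : p ∈ P(X) }`. -/
def GTrans {d : ℕ} (f : Matd d → ℝ≥0∞) (X : Set (Ed d)) (φ : Ed d → ℝ) (x : Ed d) : EReal :=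
  sInf { c : EReal | ∃ p : Measure (Ed d), IsProbabilityMeasure p ∧ p Xᶜ = 0 ∧
      c = ((∫ y, φ y ∂p : ℝ) : EReal) + (Gcost f X x p : EReal) }

/-- `φ = φ^G` on `E`. -/
def GEq {d : ℕ} (f : Matd d → ℝ≥0∞) (X : Set (Ed d)) (φ : Ed d → ℝ) (E : Set (Ed d)) : Prop :=
  ∀ x ∈ E, GTrans f X φ x = ((φ x : ℝ) : EReal)

/-- `𝒯(A) = sup { A : M | M ∈ S⁺⁺_d, f(M) = 1 }`. -/
def Tcal {d : ℕ} (f : Matd d → ℝ≥0∞) (A : Matd d) : EReal :=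
  sSup { c : EReal | ∃ M : Matd d, M.PosDef ∧ f M = 1 ∧ c = ((frob A M : ℝ) : EReal) }

/-- `u` is a viscosity supersolution of `c − 𝒯(½∇²u) = 0` in `U`. -/
def IsViscSupersol {d : ℕ} (f : Matd d → ℝ≥0∞) (c : ℝ) (u : Ed d → ℝ) (U : Set (Ed d)) : Prop :=
  ∀ φ : Ed d → ℝ, ContDiffOn ℝ 2 φ U → ∀ x ∈ U,
    IsLocalMinOn (fun y => u y - φ y) U x →
    Tcal f ((1/2 : ℝ) • hess φ x) ≤ ((c : ℝ) : EReal)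

/-- Integral of an `EReal`-valued function against a measure
(positive part minus negative part). -/
def erealInt {d : ℕ} (m : Measure (Ed d)) (u : Ed d → EReal) : EReal :=
  ((∫⁻ y, ENNReal.ofReal ((u y).toReal) ∂m : ℝ≥0∞) : EReal) -
    ((∫⁻ y, (if u y = ⊥ then (⊤ : ℝ≥0∞) else ENNReal.ofReal (-(u y).toReal)) ∂m : ℝ≥0∞) : EReal)

/-- `u : U → ℝ ∪ {−∞}` is subharmonic on the open set `U`: it is upper semicontinuous,
not identically `−∞` on any connected component, and satisfies the sub-mean value
inequality on spheres. -/
def Subharmonic {d : ℕ} (U : Set (Ed d)) (u : Ed d → EReal) : Prop :=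
  (∀ x, u x ≠ ⊤) ∧
  (∀ x ∈ U, ∃ y ∈ connectedComponentIn U x, u y ≠ ⊥) ∧
  UpperSemicontinuousOn u U ∧
  (∀ x ∈ U, ∀ r : ℝ, 0 < r → Metric.closedBall x r ⊆ U →
    (((μH[(d : ℝ) - 1] (Metric.sphere x r)).toReal : ℝ) : EReal) * u x ≤
      erealInt ((μH[(d : ℝ) - 1]).restrict (Metric.sphere x r)) u)

/-- The (topological) support of a measure. -/
def msupp {d : ℕ} (m : Measure (Ed d)) : Set (Ed d) :=
  { x | ∀ U : Set (Ed d), IsOpen U → x ∈ U → m U ≠ 0 }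

/-- `m₁ ≤_SH m₂`: subharmonic order. -/
def SHOrder {d : ℕ} (m₁ m₂ : Measure (Ed d)) : Prop :=
  ∀ U : Set (Ed d), IsOpen U → msupp (m₁ + m₂) ⊆ U →
    ∀ u : Ed d → EReal, Subharmonic U u →
      erealInt (m₁.restrict U) u ≤ erealInt (m₂.restrict U) u

/-- The second moment matrix `∫ x ⊗ x dκ`. -/
def secondMoment {d : ℕ} (κ : Measure (Ed d)) : Matd d :=
  fun i j => ∫ x, x i * x j ∂κ

end

section finite_dim
variable {d : ℕ}

theorem frob_add_left (A B M : Matd d) : frob (A + B) M = frob A M + frob B M := by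
  simp [frob, add_mul, Finset.sum_add_distrib]

theorem frob_smul_left (t : ℝ) (A M : Matd d) : frob (t • A) M = t * frob A M := by
  simp [frob, Finset.mul_sum, mul_assoc]

theorem frob_comm' (A M : Matd d) : frob A M = frob M A := by
  simp [frob, mul_comm]

theorem frob_le_matnorm (A M : Matd d) : frob A M ≤ matnorm A * matnorm M := by
  have := Real.sum_mul_le_sqrt_mul_sqrt (Finset.univ : Finset (Fin d × Fin d))
    (fun p => A p.1 p.2) (fun p => M p.1 p.2)
  simpa [frob, matnorm, Fintype.sum_prod_type, sq] using this

theorem matnorm_nonneg (A : Matd d) : 0 ≤ matnorm A := Real.sqrt_nonneg _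

theorem frob_zero_left (M : Matd d) : frob 0 M = 0 := by simp [frob]

theorem abs_frob_le (A M : Matd d) : |frob A M| ≤ matnorm A * matnorm M := by
  rw [abs_le]
  refine ⟨?_, frob_le_matnorm A M⟩
  have := frob_le_matnorm ((-1 : ℝ) • A) M
  have h2 : matnorm ((-1 : ℝ) • A) = matnorm A := by
    simp [matnorm, frob]
  rw [frob_smul_left, h2] at this
  linarith

theorem mem_domFstar_iff (f : Matd d → ℝ≥0∞) (A : Matd d) :
    A ∈ domFstar f ↔ ∀ M, f M ≠ ⊤ → frob A M ≤ (f M).toReal := by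
  refine forall₂_congr fun M hM => ?_
  rw [ENNReal.ofReal_le_iff_le_toReal hM]

theorem convex_domFstar (f : Matd d → ℝ≥0∞) : Convex ℝ (domFstar f) := by
  intro A hA B hB a b ha hb hab
  rw [mem_domFstar_iff] at *
  intro M hM
  rw [frob_add_left, frob_smul_left, frob_smul_left]
  have h1 := hA M hM
  have h2 := hB M hM
  have : (f M).toReal = a * (f M).toReal + b * (f M).toReal := by rw [← add_mul, hab, one_mul]
  rw [this]
  gcongr

theorem zero_mem_domFstar (f : Matd d → ℝ≥0∞) : (0 : Matd d) ∈ domFstar f := by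
  intro M hM
  simp [frob_zero_left]

theorem f_zero {f : Matd d → ℝ≥0∞} (hA1 : CostA1 f) : f 0 = 0 := by
  have := hA1.2.2.2 0 le_rfl 0
  simpa using this

/-- Bipolar lemma. -/
theorem bipolar {f : Matd d → ℝ≥0∞} (hA1 : CostA1 f) (hA2 : CostA2 f) (M : Matd d)
    (r : ℝ≥0) (hr : (r : ℝ≥0∞) < f M) : ∃ A ∈ domFstar f, (r : ℝ) < frob A M := by
  let V := (Fin d → Fin d → ℝ) × ℝ
  let epi : Set V := {p | f (Matrix.of p.1) ≤ ENNReal.ofReal p.2 ∧ 0 ≤ p.2}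
  have hcl : IsClosed epi := by
    have h1 : IsClosed {p : Matd d × ℝ≥0∞ | f p.1 ≤ p.2} := hA2.isClosed_epigraph
    have h2 : Continuous (fun p : V => ((Matrix.of p.1 : Matd d), ENNReal.ofReal p.2)) := by
      refine Continuous.prodMk ?_ (ENNReal.continuous_ofReal.comp continuous_snd)
      exact continuous_fst
    exact (h1.preimage h2).inter (isClosed_le continuous_const continuous_snd)
  have hcone : ∀ p ∈ epi, ∀ t : ℝ, 0 ≤ t → t • p ∈ epi := by
    rintro p ⟨hp1, hp2⟩ t ht
    refine ⟨?_, mul_nonneg ht hp2⟩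
    have := hA1.2.2.2 t ht (Matrix.of p.1)
    change f (t • Matrix.of p.1) ≤ ENNReal.ofReal (t * p.2)
    rw [this, ENNReal.ofReal_mul ht]
    gcongr
  have hadd : ∀ p ∈ epi, ∀ q ∈ epi, p + q ∈ epi := by
    rintro p ⟨hp1, hp2⟩ q ⟨hq1, hq2⟩
    refine ⟨?_, add_nonneg hp2 hq2⟩
    change f (Matrix.of p.1 + Matrix.of q.1) ≤ ENNReal.ofReal (p.2 + q.2)
    rw [ENNReal.ofReal_add hp2 hq2]
    exact (hA1.2.2.1 _ _).trans (add_le_add hp1 hq1)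
  have hconv : Convex ℝ epi := fun p hp q hq a b ha hb _ =>
    hadd _ (hcone p hp a ha) _ (hcone q hq b hb)
  have hnot : ((fun i j => M i j, (r : ℝ)) : V) ∉ epi := by
    rintro ⟨h1, -⟩
    have : f M ≤ ENNReal.ofReal (r : ℝ) := h1
    rw [ENNReal.ofReal_coe_nnreal] at this
    exact absurd hr (not_lt.mpr this)
  obtain ⟨φ, u, hu1, hu2⟩ := geometric_hahn_banach_point_closed hconv hcl hnot
  have h0 : (0 : V) ∈ epi := by
    refine ⟨?_, le_rfl⟩
    change f 0 ≤ _
    simp [f_zero hA1]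
  have hu0 : u < 0 := by simpa using hu2 0 h0
  have hpos : ∀ p ∈ epi, 0 ≤ φ p := by
    intro p hp
    by_contra hneg
    push Not at hneg
    have := hu2 _ (hcone p hp (u / φ p) (div_nonneg_of_nonpos hu0.le hneg.le))
    rw [map_smul, smul_eq_mul, div_mul_cancel₀ _ hneg.ne] at this
    exact lt_irrefl _ this
  let B : Matd d := fun i j => φ (Pi.single i (Pi.single j 1), 0)
  let b : ℝ := φ (0, 1)
  have hφ : ∀ (N : Matd d) (t : ℝ), φ ((fun i j => N i j), t) = frob B N + t * b := by
    intro N t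
    have h1 : (((fun i j => N i j), t) : V) = (∑ i, ∑ j, N i j •
        ((Pi.single i (Pi.single j 1), 0) : V)) + t • ((0, 1) : V) := by
      refine Prod.ext ?_ ?_
      · simp only [Prod.fst_add, Prod.fst_sum, Prod.smul_fst]
        ext i j
        simp [Finset.sum_apply, Pi.single_apply, apply_ite, Finset.sum_ite_eq]
      · simp [Prod.snd_sum]
    rw [h1, map_add, map_smul, map_sum]
    simp only [map_sum, map_smul, smul_eq_mul, frob, B, b]
    congr 1
    exact Finset.sum_congr rfl fun i _ => Finset.sum_congr rfl fun j _ => mul_comm _ _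
  have hb : 0 ≤ b := hpos _ ⟨by change f 0 ≤ _; simp [f_zero hA1], zero_le_one⟩
  have hM : frob B M + r * b < 0 := by
    rw [← hφ]; exact hu1.trans hu0
  have hN : ∀ N, f N ≠ ⊤ → 0 ≤ frob B N + (f N).toReal * b := by
    intro N hN
    rw [← hφ]
    refine hpos _ ⟨?_, ENNReal.toReal_nonneg⟩
    change f N ≤ ENNReal.ofReal (f N).toReal
    rw [ENNReal.ofReal_toReal hN]
  rcases hb.eq_or_lt with hb0 | hb0
  · rw [← hb0] at hM hN
    simp only [mul_zero, add_zero] at hM hN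
    refine ⟨(-((r + 1) / (-frob B M))) • B, ?_, ?_⟩
    · rw [mem_domFstar_iff]
      intro N hN'
      rw [frob_smul_left]
      have : 0 ≤ ((r + 1) / (-frob B M)) * frob B N :=
        mul_nonneg (div_nonneg (by positivity) (by linarith)) (hN N hN')
      have h3 : 0 ≤ (f N).toReal := ENNReal.toReal_nonneg
      linarith
    · rw [frob_smul_left]
      have h3 : frob B M ≠ 0 := hM.ne
      have : -((r + 1) / (-frob B M)) * frob B M = (r:ℝ) + 1 := by field_simp
      rw [this]; linarith
  · refine ⟨(-(1 / b)) • B, ?_, ?_⟩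
    · rw [mem_domFstar_iff]
      intro N hN'
      have := hN N hN'
      rw [frob_smul_left, neg_mul, one_div, inv_mul_eq_div, ← neg_div, div_le_iff₀ hb0]
      linarith
    · rw [frob_smul_left, neg_mul, one_div, inv_mul_eq_div, ← neg_div, lt_div_iff₀ hb0]
      linarith

theorem continuous_frob_left (M : Matd d) : Continuous (fun A : Matd d => frob A M) := by
  unfold frob
  fun_prop

theorem continuous_matnorm : Continuous (fun A : Matd d => matnorm A) := by
  unfold matnorm frob
  fun_prop

/-- Countable bipolar. -/
theorem exists_seq {f : Matd d → ℝ≥0∞} (hA1 : CostA1 f) (hA2 : CostA2 f) :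
    ∃ a : ℕ → Matd d, (∀ n, a n ∈ domFstar f) ∧
      ∀ M, f M = ⨆ n, ENNReal.ofReal (frob (a n) M) := by
  have : Nonempty (domFstar f) := ⟨⟨0, zero_mem_domFstar f⟩⟩
  have : SecondCountableTopology (Matd d) :=
    inferInstanceAs (SecondCountableTopology (Fin d → Fin d → ℝ))
  refine ⟨fun n => (TopologicalSpace.denseSeq (domFstar f) n : Matd d), fun n => Subtype.coe_prop _, ?_⟩
  intro M
  apply le_antisymm
  · refine le_of_forall_lt fun q hq => ?_
    lift q to ℝ≥0 using hq.ne_top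
    obtain ⟨A, hA, hlt⟩ := bipolar hA1 hA2 M q hq
    have hopen : IsOpen {A : domFstar f | (q : ℝ) < frob (A : Matd d) M} :=
      isOpen_lt continuous_const ((continuous_frob_left M).comp continuous_subtype_val)
    obtain ⟨n, hn⟩ := (TopologicalSpace.denseRange_denseSeq (domFstar f)).exists_mem_open hopen
      ⟨⟨A, hA⟩, hlt⟩
    refine lt_of_lt_of_le ?_ (le_iSup _ n)
    rw [← ENNReal.ofReal_coe_nnreal]
    exact (ENNReal.ofReal_lt_ofReal_iff_of_nonneg q.coe_nonneg).mpr hn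
  · refine iSup_le fun n => ?_
    by_cases h : f M = ⊤
    · simp [h]
    · exact (TopologicalSpace.denseSeq (domFstar f) n).2 M h

end finite_dim

section approx
set_option linter.unusedSectionVars false
variable {d : ℕ} {Y : Type*} [MetricSpace Y] [CompactSpace Y] [MeasurableSpace Y] [BorelSpace Y]

/-- Continuous `[0,1]`-valued functions converging a.e. to an indicator. -/
theorem exists_approx_indicator (m : Measure Y) [IsFiniteMeasure m] {B : Set Y}
    (hB : MeasurableSet B) :
    ∃ g : ℕ → C(Y, ℝ), (∀ k x, 0 ≤ g k x ∧ g k x ≤ 1) ∧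
      ∀ᵐ x ∂m, Tendsto (fun k => g k x) atTop (𝓝 (B.indicator (fun _ => (1:ℝ)) x)) := by
  have hmem : MemLp (B.indicator (fun _ => (1:ℝ))) 1 m :=
    (memLp_const (1:ℝ)).indicator hB
  have h1 : ∀ k : ℕ, ∃ g : BoundedContinuousFunction Y ℝ,
      eLpNorm (B.indicator (fun _ => (1:ℝ)) - (g : Y → ℝ)) 1 m ≤ ((k : ℝ≥0∞) + 1)⁻¹ ∧ MemLp g 1 m := by
    intro k
    exact hmem.exists_boundedContinuous_eLpNorm_sub_le ENNReal.one_ne_top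
      (ENNReal.inv_ne_zero.mpr (by finiteness))
  choose g hg hgm using h1
  have h2 : TendstoInMeasure m (fun k => (g k : Y → ℝ)) atTop (B.indicator (fun _ => (1:ℝ))) := by
    refine tendstoInMeasure_of_tendsto_eLpNorm (p := 1) one_ne_zero
      (fun k => (hgm k).1) hmem.1 ?_
    have h3 : Tendsto (fun k : ℕ => ((k : ℝ≥0∞) + 1)⁻¹) atTop (𝓝 0) := by
      have := (tendsto_add_atTop_iff_nat 1).2 ENNReal.tendsto_inv_nat_nhds_zero
      simpa using this
    refine tendsto_of_tendsto_of_tendsto_of_le_of_le tendsto_const_nhds h3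
      (fun _ => bot_le) (fun k => ?_)
    change eLpNorm ((g k : Y → ℝ) - B.indicator (fun _ => (1:ℝ))) 1 m ≤ _
    rw [eLpNorm_sub_comm]
    exact hg k
  obtain ⟨ns, -, hns⟩ := h2.exists_seq_tendsto_ae
  refine ⟨fun k => ⟨fun x => max 0 (min 1 (g (ns k) x)), by fun_prop⟩, fun k x => ?_, ?_⟩
  · exact ⟨le_max_left _ _, max_le zero_le_one (min_le_left _ _)⟩
  · filter_upwards [hns] with x hx
    have hc : Continuous (fun t : ℝ => max 0 (min 1 t)) := by fun_prop
    have := (hc.tendsto _).comp hx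
    have he : max 0 (min 1 (B.indicator (fun _ => (1:ℝ)) x)) = B.indicator (fun _ => (1:ℝ)) x := by
      by_cases h : x ∈ B <;> simp [h]
    rw [he] at this
    exact this

theorem exists_riesz (L : C(Y, ℝ) →ₗ[ℝ] ℝ) (hL : ∀ g : C(Y, ℝ), (∀ x, 0 ≤ g x) → 0 ≤ L g) :
    ∃ m : Measure Y, IsFiniteMeasure m ∧ ∀ g : C(Y, ℝ), L g = ∫ x, g x ∂m := by
  let L' : CompactlySupportedContinuousMap Y ℝ →ₗ[ℝ] ℝ :=
    { toFun := fun g => L (g : C(Y, ℝ))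
      map_add' := fun a b => by
        rw [← map_add]; rfl
      map_smul' := fun a b => by
        rw [← map_smul]; rfl }
  let Λ := PositiveLinearMap.mk₀ L' (fun g hg => hL _ hg)
  refine ⟨RealRMK.rieszMeasure Λ, inferInstance, fun g => ?_⟩
  have := RealRMK.integral_rieszMeasure Λ (CompactlySupportedContinuousMap.continuousMapEquiv g)
  exact this.symm

/-- Density: the pairing of a finite measure with continuous functions through a dominating
measure. -/
theorem integral_density (n m : Measure Y) [IsFiniteMeasure n] [IsFiniteMeasure m] (h : n ≪ m)
    (g : Y → ℝ) :
    ∫ x, g x ∂n = ∫ x, g x * (n.rnDeriv m x).toReal ∂m := by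
  rw [← integral_rnDeriv_smul h]
  simp [mul_comm]

theorem integrable_frob {m : Measure Y} {ρ : Y → Matd d} 
    (hρ : ∀ i j, Integrable (fun x => ρ x i j) m) (A : Matd d) :
    Integrable (fun x => frob A (ρ x)) m := by
  unfold frob
  exact integrable_finsetSum _ fun i _ => integrable_finsetSum _ fun j _ => (hρ i j).const_mul _

/-- Approximable selections. -/
def Approx (D : Set (Matd d)) (m : Measure Y) (A : Y → Matd d) : Prop :=
  ∃ (u : ℕ → C(Y, Matd d)) (C : ℝ), (∀ k x, u k x ∈ D) ∧ (∀ k x i j, |u k x i j| ≤ C) ∧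
    ∀ᵐ x ∂m, Tendsto (fun k => u k x) atTop (𝓝 (A x))

theorem approx_zero {D : Set (Matd d)} (m : Measure Y) (h0 : (0 : Matd d) ∈ D) :
    Approx D m (fun _ => 0) :=
  ⟨fun _ => 0, 0, fun _ _ => h0, fun _ _ _ _ => by simp, ae_of_all _ fun _ => tendsto_const_nhds⟩

theorem approx_piecewise {D : Set (Matd d)} {m : Measure Y} [IsFiniteMeasure m]
    (hD : Convex ℝ D) {A : Y → Matd d}
    (hA : Approx D m A) {a : Matd d} (ha : a ∈ D) {B : Set Y} (hB : MeasurableSet B) :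
    Approx D m (fun x => if x ∈ B then a else A x) := by
  obtain ⟨u, C, hu, hC, hlim⟩ := hA
  obtain ⟨g, hg, hglim⟩ := exists_approx_indicator m hB
  refine ⟨fun k => ⟨fun x => g k x • a + (1 - g k x) • u k x, by fun_prop⟩,
    |C| + ∑ i, ∑ j, |a i j|, fun k x => ?_, fun k x i j => ?_, ?_⟩
  · exact hD ha (hu k x) (hg k x).1 (by linarith [(hg k x).2]) (by ring)
  · have h1 : |a i j| ≤ ∑ i, ∑ j, |a i j| :=
      (Finset.single_le_sum (f := fun j => |a i j|) (fun _ _ => abs_nonneg _)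
        (Finset.mem_univ j)).trans
      (Finset.single_le_sum (f := fun i => ∑ j, |a i j|)
        (fun _ _ => Finset.sum_nonneg fun _ _ => abs_nonneg _) (Finset.mem_univ i))
    have h2 := (hC k x i j).trans (le_abs_self C)
    obtain ⟨h3, h4⟩ := hg k x
    change |g k x * a i j + (1 - g k x) * u k x i j| ≤ _
    refine (abs_add_le _ _).trans ?_
    rw [abs_mul, abs_mul, abs_of_nonneg h3, abs_of_nonneg (by linarith : 0 ≤ 1 - g k x)]
    have e1 : g k x * |a i j| ≤ 1 * |a i j| := by gcongr
    have e2 : (1 - g k x) * |u k x i j| ≤ 1 * |u k x i j| := by gcongr; linarith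
    linarith
  · filter_upwards [hlim, hglim] with x h1 h2
    have := (h2.smul_const a).add ((tendsto_const_nhds (x := (1:ℝ)).sub h2).smul h1)
    have he : B.indicator (fun _ => (1:ℝ)) x • a + (1 - B.indicator (fun _ => (1:ℝ)) x) • A x
        = if x ∈ B then a else A x := by
      by_cases h : x ∈ B <;> simp [h]
    rw [he] at this
    exact this

theorem approx_integral_le {D : Set (Matd d)} {m : Measure Y} [IsFiniteMeasure m]
    {ρ : Y → Matd d} (hρ : ∀ i j, Integrable (fun x => ρ x i j) m) {s : ℝ}
    (hs : ∀ u : C(Y, Matd d), (∀ x, u x ∈ D) → ∫ x, frob (u x) (ρ x) ∂m ≤ s)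
    {A : Y → Matd d} (hA : Approx D m A) :
    Integrable (fun x => frob (A x) (ρ x)) m ∧ ∫ x, frob (A x) (ρ x) ∂m ≤ s := by
  obtain ⟨u, C, hu, hC, hlim⟩ := hA
  have hbound : Integrable (fun x => ∑ i, ∑ j, C * |ρ x i j|) m :=
    integrable_finsetSum _ fun i _ => integrable_finsetSum _ fun j _ => (hρ i j).abs.const_mul _
  have hmeas : ∀ k, AEStronglyMeasurable (fun x => frob (u k x) (ρ x)) m := by
    intro k
    unfold frob
    refine Finset.aestronglyMeasurable_fun_sum _ fun i _ =>
      Finset.aestronglyMeasurable_fun_sum _ fun j _ => ?_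
    refine AEStronglyMeasurable.mul ?_ (hρ i j).1
    have : Continuous fun x => u k x i j := by fun_prop
    exact this.aestronglyMeasurable
  have hb : ∀ k x, ‖frob (u k x) (ρ x)‖ ≤ ∑ i, ∑ j, C * |ρ x i j| := by
    intro k x
    unfold frob
    refine (norm_sum_le _ _).trans (Finset.sum_le_sum fun i _ => ?_)
    refine (norm_sum_le _ _).trans (Finset.sum_le_sum fun j _ => ?_)
    rw [Real.norm_eq_abs, abs_mul]
    gcongr
    exact hC k x i j
  have hl : ∀ᵐ x ∂m, Tendsto (fun k => frob (u k x) (ρ x)) atTop (𝓝 (frob (A x) (ρ x))) := by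
    filter_upwards [hlim] with x hx
    exact ((continuous_frob_left (ρ x)).tendsto _).comp hx
  have hAm : AEStronglyMeasurable (fun x => frob (A x) (ρ x)) m :=
    aestronglyMeasurable_of_tendsto_ae atTop hmeas hl
  refine ⟨hbound.mono' hAm ?_, ?_⟩
  · filter_upwards [hl] with x hx
    exact le_of_tendsto hx.norm (Eventually.of_forall fun k => hb k x)
  · have := tendsto_integral_of_dominated_convergence _ hmeas hbound
      (fun k => ae_of_all _ (hb k)) hl
    exact le_of_tendsto this (Eventually.of_forall fun k => hs (u k) (hu k))

/-- The cost estimate. -/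
theorem lintegral_cost_le {f : Matd d → ℝ≥0∞} (hA1 : CostA1 f) (hA2 : CostA2 f)
    {m : Measure Y} [IsFiniteMeasure m] {ρ : Y → Matd d}
    (hρm : ∀ i j, Measurable (fun x => ρ x i j))
    (hρ : ∀ i j, Integrable (fun x => ρ x i j) m) {s : ℝ}
    (hs : ∀ u : C(Y, Matd d), (∀ x, u x ∈ domFstar f) → ∫ x, frob (u x) (ρ x) ∂m ≤ s) :
    Measurable (fun x => f (ρ x)) ∧ ∫⁻ x, f (ρ x) ∂m ≤ ENNReal.ofReal s := by
  obtain ⟨a, haD, ha⟩ := exists_seq hA1 hA2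
  have hfm : ∀ n, Measurable (fun x => frob (a n) (ρ x)) := by
    intro n
    unfold frob
    exact Finset.measurable_fun_sum _ fun i _ => Finset.measurable_fun_sum _ fun j _ =>
      (hρm i j).const_mul _
  have key : ∀ n : ℕ, ∃ A : Y → Matd d, Approx (domFstar f) m A ∧
      Measurable (fun x => frob (A x) (ρ x)) ∧ (∀ x, 0 ≤ frob (A x) (ρ x)) ∧
      ∀ k < n, ∀ x, frob (a k) (ρ x) ≤ frob (A x) (ρ x) := by
    intro n
    induction n with
    | zero => exact ⟨fun _ => 0, approx_zero m (zero_mem_domFstar f), by simp [frob_zero_left],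
        by simp [frob_zero_left], by simp⟩
    | succ n ih =>
      obtain ⟨A, hA, hAm, hA0, hAk⟩ := ih
      let B : Set Y := {x | frob (A x) (ρ x) < frob (a n) (ρ x)}
      have hB : MeasurableSet B := measurableSet_lt hAm (hfm n)
      have hmax : ∀ x, frob (if x ∈ B then a n else A x) (ρ x)
          = max (frob (A x) (ρ x)) (frob (a n) (ρ x)) := by
        intro x
        by_cases h : x ∈ B
        · rw [if_pos h, max_eq_right (le_of_lt h)]
        · rw [if_neg h, max_eq_left (not_lt.mp h)]
      refine ⟨_, approx_piecewise (convex_domFstar f) hA (haD n) hB, ?_, ?_, ?_⟩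
      · simp only [hmax]; exact hAm.max (hfm n)
      · intro x; rw [hmax]; exact le_max_of_le_left (hA0 x)
      · intro k hk x
        rw [hmax]
        rcases Nat.lt_succ_iff_lt_or_eq.mp hk with h | h
        · exact le_max_of_le_left (hAk k h x)
        · rw [h]; exact le_max_right _ _
  have hmeas : ∀ n, Measurable (fun x => ENNReal.ofReal (frob (a n) (ρ x))) :=
    fun n => (hfm n).ennreal_ofReal
  have hf : (fun x => f (ρ x)) = fun x => ⨆ n, ENNReal.ofReal (frob (a n) (ρ x)) :=
    funext fun x => ha _
  have hf2 : (fun x => f (ρ x)) =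
      fun x => ⨆ n : ℕ, ⨆ k : Fin n, ENNReal.ofReal (frob (a k) (ρ x)) := by
    rw [hf]
    funext x
    apply le_antisymm
    · exact iSup_le fun n => le_iSup_of_le (n+1) (le_iSup_of_le ⟨n, n.lt_succ_self⟩ le_rfl)
    · exact iSup_le fun n => iSup_le fun k => le_iSup (fun n => ENNReal.ofReal (frob (a n) (ρ x))) _
  refine ⟨by rw [hf]; exact Measurable.iSup hmeas, ?_⟩
  rw [hf2, lintegral_iSup]
  · refine iSup_le fun n => ?_
    obtain ⟨A, hA, hAm, hA0, hAk⟩ := key n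
    obtain ⟨hIntg, hle⟩ := approx_integral_le hρ hs hA
    calc ∫⁻ x, ⨆ k : Fin n, ENNReal.ofReal (frob (a k) (ρ x)) ∂m ≤ ∫⁻ x, ENNReal.ofReal (frob (A x) (ρ x)) ∂m :=
          lintegral_mono fun x => iSup_le fun k : Fin n => ENNReal.ofReal_le_ofReal (hAk k k.2 x)
      _ = ENNReal.ofReal (∫ x, frob (A x) (ρ x) ∂m) :=
          (ofReal_integral_eq_lintegral_ofReal hIntg (ae_of_all _ hA0)).symm
      _ ≤ _ := ENNReal.ofReal_le_ofReal hle
  · exact fun n => Measurable.iSup fun k => hmeas k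
  · intro n n' h x
    exact iSup_le fun k => le_iSup_of_le (⟨k, k.2.trans_le h⟩ : Fin n') le_rfl

end approx

section repr
set_option linter.unusedSectionVars false
variable {d : ℕ} {Y : Type*} [MetricSpace Y] [CompactSpace Y] [MeasurableSpace Y] [BorelSpace Y]

/-- `g ↦ g • A`. -/
def smLin (A : Matd d) : C(Y, ℝ) →ₗ[ℝ] C(Y, Matd d) where
  toFun g := ⟨fun x => g x • A, by fun_prop⟩
  map_add' a b := by ext1 x; simp [add_smul]
  map_smul' a b := by ext1 x; simp [mul_smul]

theorem smLin_apply (A : Matd d) (g : C(Y, ℝ)) (x : Y) : smLin A g x = g x • A := rfl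

theorem nonpos_of_bdd {f : Matd d → ℝ≥0∞} (Λ : C(Y, Matd d) →ₗ[ℝ] ℝ) (s : ℝ)
    (hΛ : ∀ u : C(Y, Matd d), (∀ x, u x ∈ domFstar f) → Λ u ≤ s) (u : C(Y, Matd d))
    (hu : ∀ x M, f M ≠ ⊤ → frob (u x) M ≤ 0) : Λ u ≤ 0 := by
  by_contra hpos
  push Not at hpos
  have h := hΛ (((|s| + 1) / Λ u) • u) (fun x => by
    rw [mem_domFstar_iff]
    intro M hM
    change frob (((|s| + 1) / Λ u) • u x) M ≤ _
    rw [frob_smul_left]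
    have h1 : 0 ≤ (|s| + 1) / Λ u := by positivity
    have h2 := mul_nonpos_of_nonneg_of_nonpos h1 (hu x M hM)
    exact h2.trans ENNReal.toReal_nonneg)
  rw [map_smul, smul_eq_mul, div_mul_cancel₀ _ hpos.ne'] at h
  linarith [le_abs_self s]

/-- Rank-one matrix. -/
def rankOne (ξ : Fin d → ℝ) : Matd d := fun i j => ξ i * ξ j

theorem frob_rankOne_nonneg (ξ : Fin d → ℝ) {M : Matd d} (hM : M.PosSemidef) :
    0 ≤ frob (rankOne ξ) M := by
  have h := hM.dotProduct_mulVec_nonneg ξ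
  have e : frob (rankOne ξ) M = star ξ ⬝ᵥ M.mulVec ξ := by
    simp only [frob, rankOne, dotProduct, Matrix.mulVec, Finset.mul_sum, star_trivial]
    exact Finset.sum_congr rfl fun i _ => Finset.sum_congr rfl fun j _ => by ring
  rw [e]; exact h

/-- Unit matrix. -/
def unitMat (i j : Fin d) : Matd d := fun k l => if k = i ∧ l = j then 1 else 0

theorem frob_unitMat (i j : Fin d) (M : Matd d) : frob (unitMat i j) M = M i j := by
  simp only [frob, unitMat, ite_and, ite_mul, one_mul, zero_mul]
  rw [Finset.sum_eq_single i, Finset.sum_eq_single j] <;> simp +contextual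

theorem decomp (u : C(Y, Matd d)) :
    u = ∑ i, ∑ j, smLin (unitMat i j) (⟨fun x => u x i j, by fun_prop⟩ : C(Y, ℝ)) := by
  ext x k l
  simp only [ContinuousMap.sum_apply, smLin_apply, Matrix.sum_apply, ContinuousMap.coe_mk,
    Matrix.smul_apply, unitMat, smul_eq_mul, ite_and, mul_ite, mul_one, mul_zero]
  rw [Finset.sum_eq_single k, Finset.sum_eq_single l] <;> simp +contextual [eq_comm]

theorem rankOne_polar (i j : Fin d) :
    rankOne (Pi.single i 1 + Pi.single j 1) = rankOne (Pi.single i (1:ℝ)) +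
      rankOne (Pi.single j (1:ℝ)) + (unitMat i j + unitMat j i) := by
  ext k l
  simp only [rankOne, unitMat, Matrix.add_apply, Pi.add_apply, Pi.single_apply]
  split_ifs <;> simp_all <;> norm_num

theorem exists_repr {f : Matd d → ℝ≥0∞} (hA1 : CostA1 f) (Λ : C(Y, Matd d) →ₗ[ℝ] ℝ) (s : ℝ)
    (hΛ : ∀ u : C(Y, Matd d), (∀ x, u x ∈ domFstar f) → Λ u ≤ s) :
    ∃ (m : Measure Y) (ρ : Y → Matd d), IsFiniteMeasure m ∧
      (∀ i j, Measurable (fun x => ρ x i j)) ∧ (∀ i j, Integrable (fun x => ρ x i j) m) ∧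
      ∀ u, Λ u = ∫ x, frob (u x) (ρ x) ∂m := by
  have hpos : ∀ ξ : Fin d → ℝ, ∃ m : Measure Y, IsFiniteMeasure m ∧
      ∀ g : C(Y, ℝ), Λ (smLin (rankOne ξ) g) = ∫ x, g x ∂m := by
    intro ξ
    refine exists_riesz (Λ ∘ₗ smLin (rankOne ξ)) fun g hg => ?_
    have := nonpos_of_bdd Λ s hΛ (-(smLin (rankOne ξ) g)) (fun x M hM => by
      have e : (-(smLin (rankOne ξ) g)) x = (-(g x)) • rankOne ξ := by
        simp [smLin_apply]
      rw [e, frob_smul_left]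
      exact mul_nonpos_of_nonpos_of_nonneg (by linarith [hg x])
        (frob_rankOne_nonneg ξ (hA1.1 M hM)))
    rw [map_neg] at this
    change 0 ≤ Λ (smLin (rankOne ξ) g)
    linarith
  choose n hnfin hn using hpos
  let e : Fin d → Fin d → ℝ := fun i => Pi.single i 1
  let m : Measure Y := (∑ p : Fin d × Fin d, n (e p.1 + e p.2)) + ∑ i, n (e i)
  have hmfin : IsFiniteMeasure m := by
    have : IsFiniteMeasure (∑ p : Fin d × Fin d, n (e p.1 + e p.2)) := inferInstance
    have : IsFiniteMeasure (∑ i, n (e i)) := inferInstance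
    infer_instance
  have hle1 : ∀ i j, n (e i + e j) ≤ m := by
    intro i j
    refine le_trans ?_ (Measure.le_add_right le_rfl)
    exact Finset.single_le_sum (f := fun p : Fin d × Fin d => n (e p.1 + e p.2))
      (fun _ _ => bot_le) (Finset.mem_univ (i, j))
  have hle2 : ∀ i, n (e i) ≤ m := by
    intro i
    refine le_trans ?_ (Measure.le_add_left le_rfl)
    exact Finset.single_le_sum (f := fun i => n (e i)) (fun _ _ => bot_le) (Finset.mem_univ i)
  let r : (Fin d → ℝ) → Y → ℝ := fun ξ x => ((n ξ).rnDeriv m x).toReal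
  have hrm : ∀ ξ, Measurable (r ξ) := fun ξ => (Measure.measurable_rnDeriv _ _).ennreal_toReal
  have hri : ∀ ξ, Integrable (r ξ) m := fun ξ => Measure.integrable_toReal_rnDeriv
  have hgi : ∀ (g : C(Y, ℝ)) ξ, Integrable (fun x => g x * r ξ x) m := by
    intro g ξ
    obtain ⟨C, hC⟩ := (isCompact_range g.continuous).isBounded.exists_norm_le
    exact (hri ξ).bdd_mul (c := C) g.continuous.aestronglyMeasurable
      (ae_of_all _ fun x => hC _ (mem_range_self x))
  let ρ : Y → Matd d := fun x i j => (1/2) * (r (e i + e j) x - r (e i) x - r (e j) x)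
  have hρi : ∀ i j, Integrable (fun x => ρ x i j) m := fun i j =>
    (((hri _).sub (hri _)).sub (hri _)).const_mul _
  have hentry : ∀ (g : C(Y, ℝ)) i j, Integrable (fun x => g x * ρ x i j) m ∧
      Λ (smLin (unitMat i j) g) = ∫ x, g x * ρ x i j ∂m := by
    intro g i j
    have hIntg : Integrable (fun x => (1/2 : ℝ) * (g x * r (e i + e j) x - g x * r (e i) x
        - g x * r (e j) x)) m := (((hgi _ _).sub (hgi _ _)).sub (hgi _ _)).const_mul _
    have heq : (fun x => g x * ρ x i j) = (fun x => (1/2 : ℝ) * (g x * r (e i + e j) x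
        - g x * r (e i) x - g x * r (e j) x)) := by
      funext x; simp only [ρ]; ring
    rw [heq]
    refine ⟨hIntg, ?_⟩
    have hsym : Λ (smLin (unitMat i j) g) = Λ (smLin (unitMat j i) g) := by
      have aux : ∀ (i j : Fin d), Λ (smLin (unitMat i j) g) - Λ (smLin (unitMat j i) g) ≤ 0 := by
        intro i j
        rw [← map_sub]
        refine nonpos_of_bdd Λ s hΛ _ fun x M hM => ?_
        have e1 : (smLin (unitMat i j) g - smLin (unitMat j i) g) x
            = (g x) • unitMat i j + (-(g x)) • unitMat j i := by
          simp [smLin_apply, sub_eq_add_neg]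
        rw [e1, frob_add_left, frob_smul_left, frob_smul_left, frob_unitMat, frob_unitMat]
        have := (hA1.1 M hM).1.apply i j
        simp only [star_trivial] at this
        rw [this]; linarith
      linarith [aux i j, aux j i]
    have hpol : smLin (rankOne (e i + e j)) g = smLin (rankOne (e i)) g + smLin (rankOne (e j)) g
        + (smLin (unitMat i j) g + smLin (unitMat j i) g) := by
      ext1 x
      simp only [ContinuousMap.add_apply, smLin_apply, e, rankOne_polar, smul_add]
    have hL := congrArg Λ hpol
    rw [map_add, map_add, map_add, ← hsym, hn, hn, hn,
      integral_density _ m (Measure.absolutelyContinuous_of_le (hle1 i j)),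
      integral_density _ m (Measure.absolutelyContinuous_of_le (hle2 i)),
      integral_density _ m (Measure.absolutelyContinuous_of_le (hle2 j))] at hL
    have hi2 : Integrable (fun x => g x * r (e i + e j) x - g x * r (e i) x) m :=
      (hgi _ _).sub (hgi _ _)
    rw [integral_const_mul, integral_sub hi2 (hgi _ _), integral_sub (hgi _ _) (hgi _ _)]
    simp only [r]
    linarith
  refine ⟨m, ρ, hmfin, fun i j => ?_, hρi, fun u => ?_⟩
  · exact (((hrm _).sub (hrm _)).sub (hrm _)).const_mul _
  · have hu := congrArg Λ (decomp u)
    rw [hu]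
    simp only [map_sum, frob]
    rw [integral_finsetSum]
    · refine Finset.sum_congr rfl fun i _ => ?_
      rw [integral_finsetSum]
      · exact Finset.sum_congr rfl fun j _ => (hentry _ i j).2
      · exact fun j _ => (hentry ⟨fun x => u x i j, by fun_prop⟩ i j).1
    · exact fun i _ => integrable_finsetSum _ fun j _ =>
        (hentry ⟨fun x => u x i j, by fun_prop⟩ i j).1

end repr

/-- Abstract Hahn-Banach step. -/
theorem exists_extension_aux {W E : Type*} [AddCommGroup W] [Module ℝ W] [AddCommGroup E]
    [Module ℝ E] (T : W →ₗ[ℝ] E) (l : W →ₗ[ℝ] ℝ) (K : Set E) (hK : Convex ℝ K)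
    (habs : Absorbent ℝ K) (s : ℝ) (h0 : (0 : E) ∈ K)
    (hl : ∀ w, T w ∈ K → l w ≤ s) :
    ∃ Λ : E →ₗ[ℝ] ℝ, (∀ w, Λ (T w) = l w) ∧ ∀ u ∈ K, Λ u ≤ s := by
  have hs : 0 ≤ s := by
    have := hl 0 (by rwa [map_zero])
    rwa [map_zero] at this
  have hker : ∀ w, T w = 0 → l w = 0 := by
    have aux : ∀ w, T w = 0 → l w ≤ 0 := by
      intro w hw
      by_contra hpos
      push Not at hpos
      have := hl (((s + 1) / l w) • w) (by rw [map_smul, hw, smul_zero]; exact h0)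
      rw [map_smul, smul_eq_mul, div_mul_cancel₀ _ hpos.ne'] at this
      linarith
    intro w hw
    have h1 := aux w hw
    have h2 := aux (-w) (by rw [map_neg, hw, neg_zero])
    rw [map_neg] at h2
    linarith
  obtain ⟨g, hg⟩ := LinearMap.exists_rightInverse_of_surjective T.rangeRestrict
    (LinearMap.range_rangeRestrict T)
  have hTg : ∀ y : LinearMap.range T, T (g y) = y := by
    intro y
    have := congrArg Subtype.val (LinearMap.congr_fun hg y)
    simpa using this
  have hlg : ∀ w, l (g ⟨T w, LinearMap.mem_range_self T w⟩) = l w := by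
    intro w
    have := hker (g ⟨T w, LinearMap.mem_range_self T w⟩ - w) (by rw [map_sub, hTg, sub_self])
    rw [map_sub] at this
    linarith
  obtain ⟨Λ, hΛ1, hΛ2⟩ := exists_extension_of_le_sublinear
    (⟨LinearMap.range T, l ∘ₗ g⟩ : E →ₗ.[ℝ] ℝ) (fun u => s * gauge K u)
    (fun c hc x => by
      change s * gauge K (c • x) = c * (s * gauge K x)
      rw [gauge_smul_of_nonneg hc.le, smul_eq_mul]; ring)
    (fun x y => by
      have := gauge_add_le hK habs x y
      have := mul_le_mul_of_nonneg_left this hs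
      linarith)
    (by
      rintro ⟨y, w, rfl⟩
      change l (g ⟨T w, _⟩) ≤ s * gauge K (T w)
      rw [hlg]
      have key : ∀ ε : ℝ, 0 < ε → l w ≤ s * (gauge K (T w) + ε) := by
        intro ε hε
        obtain ⟨b, hb, hblt, k, hk, hbk⟩ := exists_lt_of_gauge_lt habs
          (show gauge K (T w) < gauge K (T w) + ε by linarith)
        have h1 := hl (b⁻¹ • w) (by
          rw [map_smul, ← hbk]
          change b⁻¹ • b • k ∈ K
          rw [inv_smul_smul₀ hb.ne']; exact hk)
        rw [map_smul, smul_eq_mul, inv_mul_le_iff₀ hb] at h1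
        have := mul_le_mul_of_nonneg_left hblt.le hs
        linarith
      by_contra hlt
      push Not at hlt
      have h1 := key ((l w - s * gauge K (T w)) / (2 * (s + 1))) (by
        apply div_pos <;> linarith)
      have h2 : s * ((l w - s * gauge K (T w)) / (2 * (s + 1)))
          ≤ (l w - s * gauge K (T w)) / 2 := by
        rw [mul_div_assoc', div_le_div_iff₀ (by linarith) (by norm_num)]
        nlinarith
      linarith)
  refine ⟨Λ, fun w => ?_, fun u hu => ?_⟩
  · have := hΛ1 ⟨T w, LinearMap.mem_range_self T w⟩
    exact this.trans (hlg w)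
  · have h1 := hΛ2 u
    have h2 := mul_le_mul_of_nonneg_left (gauge_le_one_of_mem hu) hs
    exact h1.trans (by simpa using h2)

section hessian
variable {d : ℕ}

/-- `C²_c` as a submodule. -/
def C2cSub (d : ℕ) : Submodule ℝ (Ed d → ℝ) where
  carrier := {φ | IsC2c φ}
  zero_mem' := ⟨contDiff_const, HasCompactSupport.zero⟩
  add_mem' ha hb := ⟨ha.1.add hb.1, ha.2.add hb.2⟩
  smul_mem' c _ hx := ⟨contDiff_const.smul hx.1, hx.2.smul_left⟩

theorem hess_add {φ ψ : Ed d → ℝ} (h1 : IsC2c φ) (h2 : IsC2c ψ) (x : Ed d) :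
    hess (φ + ψ) x = hess φ x + hess ψ x := by
  ext i j
  simp only [hess, Matrix.add_apply]
  rw [iteratedFDeriv_add_apply h1.1.contDiffAt h2.1.contDiffAt]
  rfl

theorem hess_smul {φ : Ed d → ℝ} (c : ℝ) (h1 : IsC2c φ) (x : Ed d) :
    hess (c • φ) x = c • hess φ x := by
  ext i j
  simp only [hess, Matrix.smul_apply]
  rw [iteratedFDeriv_const_smul_apply h1.1.contDiffAt]
  rfl

theorem continuous_hess {φ : Ed d → ℝ} (h1 : IsC2c φ) : Continuous (hess φ) := by
  refine continuous_pi fun i => continuous_pi fun j => ?_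
  have := h1.1.continuous_iteratedFDeriv (m := 2) le_rfl
  simp only [hess]
  exact (ContinuousMultilinearMap.apply ℝ (fun _ : Fin 2 => Ed d) ℝ
    ![EuclideanSpace.single i 1, EuclideanSpace.single j 1]).continuous.comp this

/-- The half Hessian operator. -/
noncomputable def hessLin (X : Set (Ed d)) : C2cSub d →ₗ[ℝ] C(X, Matd d) where
  toFun φ := ⟨fun x => (1/2 : ℝ) • hess φ.1 x.1,
    (Continuous.const_smul (g := fun x : X => hess φ.1 x.1)
      ((continuous_hess φ.2).comp continuous_subtype_val) (1/2 : ℝ))⟩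
  map_add' a b := by
    ext1 x
    change (1/2 : ℝ) • hess (a.1 + b.1) x.1 = (1/2 : ℝ) • hess a.1 x.1 + (1/2 : ℝ) • hess b.1 x.1
    rw [hess_add a.2 b.2, smul_add]
  map_smul' c a := by
    ext1 x
    change (1/2 : ℝ) • hess (c • a.1) x.1 = c • ((1/2 : ℝ) • hess a.1 x.1)
    rw [hess_smul c a.2, smul_comm]

theorem c2c_integrable {φ : Ed d → ℝ} (h1 : IsC2c φ) (μ : Measure (Ed d)) [IsFiniteMeasure μ] :
    Integrable φ μ := h1.1.continuous.integrable_of_hasCompactSupport h1.2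

/-- The functional `φ ↦ ∫ φ dν - ∫ φ dμ`. -/
noncomputable def diffLin (μ ν : Measure (Ed d)) [IsFiniteMeasure μ] [IsFiniteMeasure ν] :
    C2cSub d →ₗ[ℝ] ℝ where
  toFun φ := ∫ x, φ.1 x ∂ν - ∫ x, φ.1 x ∂μ
  map_add' a b := by
    change ∫ x, (a.1 x + b.1 x) ∂ν - ∫ x, (a.1 x + b.1 x) ∂μ = _
    rw [integral_add (c2c_integrable a.2 _) (c2c_integrable b.2 _),
      integral_add (c2c_integrable a.2 _) (c2c_integrable b.2 _)]
    ring
  map_smul' c a := by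
    change ∫ x, (c * a.1 x) ∂ν - ∫ x, (c * a.1 x) ∂μ = c * _
    rw [integral_const_mul, integral_const_mul]
    ring

end hessian

section Kset
variable {d : ℕ} {Y : Type*} [TopologicalSpace Y] [CompactSpace Y]

/-- Continuous fields with values in `dom f⋆`. -/
def Kset (Y : Type*) [TopologicalSpace Y] (f : Matd d → ℝ≥0∞) : Set C(Y, Matd d) :=
  {u | ∀ x, u x ∈ domFstar f}

theorem convex_Kset (f : Matd d → ℝ≥0∞) : Convex ℝ (Kset Y f) := by
  intro u hu v hv a b ha hb hab x
  exact convex_domFstar f (hu x) (hv x) ha hb hab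

theorem absorbent_Kset {f : Matd d → ℝ≥0∞} (hA1 : CostA1 f) : Absorbent ℝ (Kset Y f) := by
  obtain ⟨c, hc, hcf⟩ := hA1.2.1
  intro u
  obtain ⟨C, hC⟩ := (isCompact_range (continuous_matnorm.comp u.continuous)).isBounded.exists_norm_le
  rw [absorbs_iff_norm]
  refine ⟨max 1 (C / c), fun a ha => ?_⟩
  rw [singleton_subset_iff]
  have ha1 : 1 ≤ ‖a‖ := (le_max_left _ _).trans ha
  have ha2 : C / c ≤ ‖a‖ := (le_max_right _ _).trans ha
  have ha0 : a ≠ 0 := by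
    rintro rfl
    rw [norm_zero] at ha1
    linarith
  rw [mem_smul_set_iff_inv_smul_mem₀ ha0]
  intro x
  rw [mem_domFstar_iff]
  intro M hM
  change frob (a⁻¹ • u x) M ≤ _
  rw [frob_smul_left]
  have h1 : c * matnorm M ≤ (f M).toReal := (ENNReal.ofReal_le_iff_le_toReal hM).1 (hcf M)
  have h2 : matnorm (u x) ≤ C := (le_abs_self _).trans (hC _ (mem_range_self x))
  have hapos : 0 < ‖a‖ := by linarith
  calc a⁻¹ * frob (u x) M ≤ |a⁻¹ * frob (u x) M| := le_abs_self _
    _ = ‖a‖⁻¹ * |frob (u x) M| := by rw [abs_mul, abs_inv]; rfl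
    _ ≤ ‖a‖⁻¹ * (matnorm (u x) * matnorm M) := by gcongr; exact abs_frob_le _ _
    _ ≤ ‖a‖⁻¹ * ((‖a‖ * c) * matnorm M) := by
        have : C ≤ ‖a‖ * c := (div_le_iff₀ hc).1 ha2
        have := matnorm_nonneg M
        gcongr
        linarith
    _ = c * matnorm M := by field_simp
    _ ≤ _ := h1

end Kset

theorem weak_duality {d : ℕ} (f : Matd d → ℝ≥0∞) (X : Set (Ed d)) (μ ν : Measure (Ed d)) :
    sSup { c : ℝ≥0∞ | ∃ ψ : Ed d → ℝ, IsC2c ψ ∧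
        (∀ x ∈ X, (1/2 : ℝ) • hess ψ x ∈ domFstar f) ∧
        c = ENNReal.ofReal (∫ x, ψ x ∂ν - ∫ x, ψ x ∂μ) } ≤ Fstat f X μ ν := by
  refine sSup_le ?_
  rintro _ ⟨ψ, hψ, hadm, rfl⟩
  refine le_sInf ?_
  rintro _ ⟨m, ρ, ⟨hfin, hmX, hpsd, hcomp⟩, rfl⟩
  rw [← hcomp ψ hψ]
  have h1 : ENNReal.ofReal (∫ x, (1/2 : ℝ) * frob (hess ψ x) (ρ x) ∂m)
      ≤ ∫⁻ x, ENNReal.ofReal ((1/2 : ℝ) * frob (hess ψ x) (ρ x)) ∂m := by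
    by_cases hIntg : Integrable (fun x => (1/2 : ℝ) * frob (hess ψ x) (ρ x)) m
    · rw [integral_eq_lintegral_pos_part_sub_lintegral_neg_part hIntg]
      refine (ENNReal.ofReal_le_ofReal (sub_le_self _ ENNReal.toReal_nonneg)).trans ?_
      exact ENNReal.ofReal_toReal_le
    · rw [integral_undef hIntg]; simp
  refine h1.trans (lintegral_mono_ae ?_)
  have hae : ∀ᵐ x ∂m, x ∈ X := by
    rw [ae_iff]; exact hmX
  filter_upwards [hae] with x hx
  by_cases ht : f (ρ x) = ⊤
  · rw [ht]; exact le_top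
  · rw [← frob_smul_left]
    exact hadm x hx (ρ x) ht

/-- Theorem 3.5, duality. For `μ, ν ∈ M₊(X)` with `μ(X) = ν(X)`,
`F(μ,ν) = sup { ⟨ν − μ, ψ⟩ : ψ ∈ C²_c(ℝ^d), ½∇²ψ(X) ⊆ dom(f⋆) }`. -/
theorem stmt4 {d : ℕ} (hd : 0 < d) (f : Matd d → ℝ≥0∞) (hA1 : CostA1 f) (hA2 : CostA2 f)
    (Ω X : Set (Ed d)) (hΩopen : IsOpen Ω) (hΩconv : Convex ℝ Ω)
    (hΩbdd : Bornology.IsBounded Ω) (hΩne : Ω.Nonempty) (hX : X = closure Ω)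
    (μ ν : Measure (Ed d)) [IsFiniteMeasure μ] [IsFiniteMeasure ν]
    (hμX : μ Xᶜ = 0) (hνX : ν Xᶜ = 0) (hmass : μ X = ν X) :
    Fstat f X μ ν =
      sSup { c : ℝ≥0∞ | ∃ ψ : Ed d → ℝ, IsC2c ψ ∧
        (∀ x ∈ X, (1/2 : ℝ) • hess ψ x ∈ domFstar f) ∧
        c = ENNReal.ofReal (∫ x, ψ x ∂ν - ∫ x, ψ x ∂μ) } := by
  refine le_antisymm ?_ (weak_duality f X μ ν)
  set S := sSup { c : ℝ≥0∞ | ∃ ψ : Ed d → ℝ, IsC2c ψ ∧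
        (∀ x ∈ X, (1/2 : ℝ) • hess ψ x ∈ domFstar f) ∧
        c = ENNReal.ofReal (∫ x, ψ x ∂ν - ∫ x, ψ x ∂μ) } with hS
  by_cases hStop : S = ⊤
  · rw [hStop]; exact le_top
  have hXc : IsCompact X := by
    rw [hX]; exact hΩbdd.isCompact_closure
  have hXm : MeasurableSet X := hXc.isClosed.measurableSet
  haveI : CompactSpace X := isCompact_iff_compactSpace.1 hXc
  obtain ⟨Λ, hΛ1, hΛ2⟩ := exists_extension_aux (hessLin X) (diffLin μ ν) (Kset X f)
    (convex_Kset f) (absorbent_Kset hA1) S.toReal (fun x => zero_mem_domFstar f) (by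
      intro w hw
      have h1 : ENNReal.ofReal (diffLin μ ν w) ≤ S :=
        le_sSup ⟨w.1, w.2, fun x hx => hw ⟨x, hx⟩, rfl⟩
      exact (ENNReal.ofReal_le_iff_le_toReal hStop).1 h1)
  obtain ⟨m, ρ, hmfin, hρm, hρi, hrep⟩ := exists_repr hA1 Λ S.toReal (fun u hu => hΛ2 u hu)
  obtain ⟨hfm, hcost⟩ := lintegral_cost_le hA1 hA2 hρm hρi (s := S.toReal)
    (fun u hu => by rw [← hrep]; exact hΛ2 u hu)
  rw [ENNReal.ofReal_toReal hStop] at hcost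
  have hpsd : ∀ᵐ x ∂m, (ρ x).PosSemidef := by
    filter_upwards [ae_lt_top hfm (lt_of_le_of_lt hcost (lt_top_iff_ne_top.2 hStop)).ne] with x hx
    exact hA1.1 _ hx.ne
  let ρ' : Ed d → Matd d := fun x =>
    if h : x ∈ X then (if (ρ ⟨x, h⟩).PosSemidef then ρ ⟨x, h⟩ else 0) else 0
  have hρ' : ∀ᵐ x ∂m, ρ' x.1 = ρ x := by
    filter_upwards [hpsd] with x hx
    simp only [ρ', x.2, dif_pos, Subtype.coe_eta, if_pos hx]
  have hemb : MeasurableEmbedding (Subtype.val : X → Ed d) := MeasurableEmbedding.subtype_coe hXm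
  suffices hc : IsStaticCompetitor X μ ν (m.map Subtype.val) ρ' ∧
      ∫⁻ x, f (ρ' x) ∂(m.map Subtype.val) ≤ S from
    le_trans (sInf_le ⟨m.map Subtype.val, ρ', hc.1, rfl⟩) hc.2
  refine ⟨⟨inferInstance, ?_, ?_, ?_⟩, ?_⟩
  · rw [hemb.map_apply]
    simp
  · intro x
    simp only [ρ']
    split_ifs with h1 h2
    · exact h2
    · exact Matrix.PosSemidef.zero
    · exact Matrix.PosSemidef.zero
  · intro φ hφ
    have h1 := hΛ1 ⟨φ, hφ⟩
    rw [hrep] at h1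
    rw [hemb.integral_map]
    refine Eq.trans (integral_congr_ae ?_) h1
    filter_upwards [hρ'] with x hx
    rw [hx, ← frob_smul_left]
    rfl
  · rw [hemb.lintegral_map]
    refine le_trans (le_of_eq (lintegral_congr_ae ?_)) hcost
    filter_upwards [hρ'] with x hx
    rw [hx]
end

section
/- For every μ, ν ∈ M(X), H(μ,ν) ≥ F(μ,ν); that is, the static optimal transport value with cost G dominates the dynamic Fokker–Planck value. -/
open MeasureTheory Set Filter Topology
open scoped ENNReal NNReal Classical

/-- Approximation of a lower semicontinuous function from below by continuous ones. -/
lemma aux_lsc_lintegral {Y : Type*} [PseudoEMetricSpace Y] [MeasurableSpace Y]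
    [OpensMeasurableSpace Y] (θ : Measure Y) (F : Y → ℝ≥0∞) (hF : LowerSemicontinuous F)
    (C : ℝ≥0∞)
    (h : ∀ g : Y → ℝ≥0∞, Continuous g → (∀ y, g y ≠ ⊤) → (∀ y, g y ≤ F y) → ∫⁻ y, g y ∂θ ≤ C) :
    ∫⁻ y, F y ∂θ ≤ C := by
  let g : ℕ → Y → ℝ≥0∞ := fun n y => ⨅ z, (min (F z) n + n * edist y z)
  have hgc : ∀ n, Continuous (g n) := by
    intro n
    refine continuous_of_le_add_edist (n : ℝ≥0∞) (by simp) ?_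
    intro x y
    simp only [g]
    rw [ENNReal.iInf_add]
    refine le_iInf fun z => (iInf_le _ z).trans ?_
    rw [add_assoc, ← mul_add]
    gcongr
    rw [add_comm]
    exact edist_triangle x y z
  have hgle : ∀ n y, g n y ≤ min (F y) n := by
    intro n y
    exact (iInf_le _ y).trans (by simp)
  have hmono : Monotone g := by
    intro n m hnm y
    have : (n : ℝ≥0∞) ≤ m := by exact_mod_cast hnm
    refine iInf_mono fun z => ?_
    gcongr
  have hsup : ∀ y, ⨆ n, g n y = F y := by
    intro y
    apply le_antisymm
    · exact iSup_le fun n => (hgle n y).trans (min_le_left _ _)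
    · refine le_of_forall_lt fun a ha => ?_
      obtain ⟨b, hab, hb⟩ := exists_between ha
      have hev := hF y b hb
      obtain ⟨δ, hδ, hball⟩ := EMetric.mem_nhds_iff.1 hev
      have hbt : b ≠ ⊤ := hb.ne_top
      obtain ⟨n1, hn1⟩ := ENNReal.exists_nat_gt hbt
      obtain ⟨n2, hn2⟩ := ENNReal.exists_nat_mul_gt hδ.ne' hbt
      refine hab.trans_le (le_trans ?_ (le_iSup _ (max n1 n2)))
      refine le_iInf fun z => ?_
      have c1 : (n1 : ℝ≥0∞) ≤ (max n1 n2 : ℕ) := by exact_mod_cast le_max_left _ _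
      have c2 : (n2 : ℝ≥0∞) ≤ (max n1 n2 : ℕ) := by exact_mod_cast le_max_right _ _
      by_cases hz : edist y z < δ
      · have : b < F z := hball (by simpa [edist_comm] using hz)
        exact le_trans (le_min this.le (hn1.le.trans c1)) le_self_add
      · push Not at hz
        refine le_trans (hn2.le.trans ?_) le_add_self
        gcongr
  calc ∫⁻ y, F y ∂θ = ∫⁻ y, ⨆ n, g n y ∂θ := by simp_rw [hsup]
    _ = ⨆ n, ∫⁻ y, g n y ∂θ := lintegral_iSup (fun n => (hgc n).measurable) hmono
    _ ≤ C := iSup_le fun n => h _ (hgc n)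
      (fun y => ((hgle n y).trans (min_le_right _ _)).trans_lt (by simp) |>.ne)
      (fun y => (hgle n y).trans (min_le_left _ _))

/-- Jensen's inequality for lower semicontinuous sublinear functions. -/
lemma aux_jensen {E : Type*} [NormedAddCommGroup E] [NormedSpace ℝ E] [CompleteSpace E]
    (f : E → ℝ≥0∞) (hsub : ∀ A B, f (A + B) ≤ f A + f B)
    (hhom : ∀ t : ℝ, 0 ≤ t → ∀ A, f (t • A) = ENNReal.ofReal t * f A)
    (hf : LowerSemicontinuous f) {S : Type*} [MeasurableSpace S] (P : Measure S)
    [IsProbabilityMeasure P] (g : S → E) (hg : Integrable g P)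
    (hfg : Measurable fun s => f (g s)) :
    f (∫ s, g s ∂P) ≤ ∫⁻ s, f (g s) ∂P := by
  by_cases htop : ∫⁻ s, f (g s) ∂P = ⊤
  · rw [htop]; exact le_top
  let K : Set (E × ℝ) := {p | f p.1 ≤ ENNReal.ofReal p.2} ∩ {p | 0 ≤ p.2}
  have hKc : IsClosed K := by
    refine IsClosed.inter ?_ (isClosed_le continuous_const continuous_snd)
    exact hf.isClosed_epigraph.preimage
      (continuous_fst.prodMk (ENNReal.continuous_ofReal.comp continuous_snd))
  have hKconv : Convex ℝ K := by
    rintro ⟨A, s⟩ ⟨hA, hs⟩ ⟨B, t⟩ ⟨hB, ht⟩ a b ha hb hab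
    simp only [mem_ofPred_eq] at hA hs hB ht
    refine ⟨?_, ?_⟩
    · simp only [mem_ofPred_eq, Prod.smul_mk, Prod.mk_add_mk, smul_eq_mul]
      refine (hsub _ _).trans ?_
      rw [hhom a ha, hhom b hb, ENNReal.ofReal_add (by positivity) (by positivity),
        ENNReal.ofReal_mul ha, ENNReal.ofReal_mul hb]
      gcongr
    · simp only [mem_ofPred_eq, Prod.smul_mk, Prod.mk_add_mk, smul_eq_mul]
      positivity
  have hintg : Integrable (fun s => (f (g s)).toReal) P :=
    integrable_toReal_of_lintegral_ne_top hfg.aemeasurable htop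
  have hae : ∀ᵐ s ∂P, f (g s) < ⊤ := ae_lt_top hfg htop
  have hmem := hKconv.integral_mem hKc (f := fun s => (g s, (f (g s)).toReal)) (μ := P)
    (by
      filter_upwards [hae] with s hs
      exact ⟨by simp [ENNReal.ofReal_toReal hs.ne], by simp⟩) (hg.prodMk hintg)
  rw [integral_pair hg hintg] at hmem
  refine hmem.1.trans ?_
  simp only
  rw [integral_toReal hfg.aemeasurable hae, ENNReal.ofReal_toReal htop]

open CompactlySupported in
/-- Abstract duality: Hahn-Banach plus Riesz-Markov-Kakutani. -/
lemma aux_duality {Y : Type*} [MetricSpace Y] [CompactSpace Y] [MeasurableSpace Y] [BorelSpace Y]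
    (F : Y → ℝ≥0∞) (hF : LowerSemicontinuous F) (c : ℝ) (hc : 0 < c)
    (hcF : ∀ y, ENNReal.ofReal c ≤ F y)
    {V : Type*} [AddCommGroup V] [Module ℝ V] (T : V →ₗ[ℝ] C_c(Y, ℝ)) (L : V →ₗ[ℝ] ℝ)
    (C : ℝ) (hC : 0 ≤ C)
    (h : ∀ v (t : ℝ), 0 < t → (∀ y, ENNReal.ofReal (T v y) ≤ ENNReal.ofReal t * F y) →
      L v ≤ t * C) :
    ∃ θ : Measure Y, IsFiniteMeasure θ ∧ (∀ v, ∫ y, T v y ∂θ = L v) ∧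
      ∫⁻ y, F y ∂θ ≤ ENNReal.ofReal C := by
  let D : C_c(Y, ℝ) → Set ℝ := fun g =>
    {t | 0 < t ∧ ∀ y, ENNReal.ofReal (g y) ≤ ENNReal.ofReal t * F y}
  have hDbdd : ∀ g, BddBelow (D g) := fun g => ⟨0, fun t ht => ht.1.le⟩
  have hDne : ∀ g, (D g).Nonempty := by
    intro g
    obtain ⟨B, hB⟩ := (isCompact_range g.continuous).bddAbove
    refine ⟨(|B| + 1) / c, by positivity, fun y => ?_⟩
    have h1 : g y ≤ |B| + 1 := by
      have : g y ≤ B := hB (mem_range_self y)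
      have := le_abs_self B
      linarith
    calc ENNReal.ofReal (g y) ≤ ENNReal.ofReal ((|B| + 1) / c * c) := by
          apply ENNReal.ofReal_le_ofReal
          rw [div_mul_cancel₀ _ hc.ne']; exact h1
      _ = ENNReal.ofReal ((|B| + 1) / c) * ENNReal.ofReal c := ENNReal.ofReal_mul (by positivity)
      _ ≤ _ := by gcongr; exact hcF y
  let p : C_c(Y, ℝ) → ℝ := fun g => sInf (D g)
  have hp_hom : ∀ a : ℝ, 0 < a → ∀ g, p (a • g) ≤ a * p g := by
    intro a ha g
    have : p (a • g) / a ≤ p g := by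
      refine le_csInf (hDne g) fun t ht => ?_
      rw [div_le_iff₀ ha]
      refine csInf_le (hDbdd _) ⟨mul_pos ht.1 ha, fun y => ?_⟩
      have := ht.2 y
      simp only [CompactlySupportedContinuousMap.coe_smul, Pi.smul_apply, smul_eq_mul]
      rw [ENNReal.ofReal_mul ha.le, ENNReal.ofReal_mul ht.1.le, mul_comm (ENNReal.ofReal t),
        mul_assoc]
      gcongr
    rw [div_le_iff₀ ha] at this
    linarith
  have hp_add : ∀ g g', p (g + g') ≤ p g + p g' := by
    intro g g'
    refine le_of_forall_pos_le_add fun ε hε => ?_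
    obtain ⟨t, ht, htl⟩ := exists_lt_of_csInf_lt (hDne g)
      (show sInf (D g) < sInf (D g) + ε / 2 by linarith)
    obtain ⟨t', ht', htl'⟩ := exists_lt_of_csInf_lt (hDne g')
      (show sInf (D g') < sInf (D g') + ε / 2 by linarith)
    have : p (g + g') ≤ t + t' := by
      refine csInf_le (hDbdd _) ⟨add_pos ht.1 ht'.1, fun y => ?_⟩
      simp only [CompactlySupportedContinuousMap.coe_add, Pi.add_apply]
      rw [ENNReal.ofReal_add ht.1.le ht'.1.le, add_mul]
      exact ENNReal.ofReal_add_le.trans (add_le_add (ht.2 y) (ht'.2 y))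
    simp only [p] at this ⊢
    linarith
  let N : C_c(Y, ℝ) → ℝ := fun g => C * p g
  have hLN : ∀ v, L v ≤ N (T v) := by
    intro v
    rcases hC.eq_or_lt with h0 | h0
    · obtain ⟨t, ht⟩ := hDne (T v)
      have := h v t ht.1 ht.2
      simp only [N, ← h0] at this ⊢
      linarith
    · have : L v / C ≤ p (T v) := by
        refine le_csInf (hDne _) fun t ht => ?_
        rw [div_le_iff₀ h0]
        exact h v t ht.1 ht.2
      rw [div_le_iff₀ h0] at this
      simp only [N]; linarith
  have hpneg : ∀ g : C_c(Y, ℝ), (∀ y, g y ≤ 0) → p g ≤ 0 := by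
    intro g hg
    refine le_of_forall_pos_le_add fun ε hε => ?_
    rw [zero_add]
    exact csInf_le (hDbdd _) ⟨hε, fun y => by simp [ENNReal.ofReal_of_nonpos (hg y)]⟩
  have hker : LinearMap.ker T ≤ LinearMap.ker L := by
    intro v hv
    rw [LinearMap.mem_ker] at hv ⊢
    have key : ∀ w, T w = 0 → L w ≤ 0 := by
      intro w hw
      have h1 := hLN w
      have h2 : p (T w) ≤ 0 := hpneg _ (by simp [hw])
      have : C * p (T w) ≤ 0 := mul_nonpos_of_nonneg_of_nonpos hC h2
      exact h1.trans this
    have h1 := key v hv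
    have h2 := key (-v) (by simp [hv])
    rw [map_neg] at h2
    linarith
  let L' : LinearMap.range T →ₗ[ℝ] ℝ :=
    ((LinearMap.ker T).liftQ L hker) ∘ₗ (T.quotKerEquivRange.symm : _ →ₗ[ℝ] _)
  have hL' : ∀ v, L' ⟨T v, LinearMap.mem_range_self T v⟩ = L v := by
    intro v
    have : T.quotKerEquivRange.symm ⟨T v, LinearMap.mem_range_self T v⟩
        = (LinearMap.ker T).mkQ v := LinearMap.quotKerEquivRange_symm_apply_image T v _
    simp [L', this]
  obtain ⟨Λ, hΛ, hΛN⟩ := exists_extension_of_le_sublinear ⟨LinearMap.range T, L'⟩ N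
    (by
      intro a ha g
      have h1 := hp_hom a ha g
      have h2 := hp_hom a⁻¹ (inv_pos.2 ha) (a • g)
      rw [smul_smul, inv_mul_cancel₀ ha.ne', one_smul] at h2
      have h3 : a * p g ≤ p (a • g) := by
        have := mul_le_mul_of_nonneg_left h2 ha.le
        rwa [← mul_assoc, mul_inv_cancel₀ ha.ne', one_mul] at this
      have : p (a • g) = a * p g := le_antisymm h1 h3
      simp only [N, this]; ring)
    (by
      intro g g'
      have := mul_le_mul_of_nonneg_left (hp_add g g') hC
      simp only [N]; linarith)
    (by
      rintro ⟨_, v, rfl⟩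
      exact (hL' v).trans_le (hLN v))
  let P : C_c(Y, ℝ) →ₚ[ℝ] ℝ := PositiveLinearMap.mk₀ Λ (by
    intro g hg
    have h1 := hΛN (-g)
    have h2 : p (-g) ≤ 0 := hpneg _ (fun y => by
      have : (0 : ℝ) ≤ g y := hg y
      simpa using this)
    have : C * p (-g) ≤ 0 := mul_nonpos_of_nonneg_of_nonpos hC h2
    rw [map_neg] at h1
    have : -Λ g ≤ 0 := h1.trans this
    linarith)
  have hfin : IsFiniteMeasure (RealRMK.rieszMeasure P) := by
    have : (RealRMK.rieszMeasure P).Regular := by unfold RealRMK.rieszMeasure; infer_instance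
    exact ⟨isCompact_univ.measure_lt_top⟩
  refine ⟨RealRMK.rieszMeasure P, hfin, ?_, ?_⟩
  · intro v
    rw [RealRMK.integral_rieszMeasure]
    exact (hΛ ⟨T v, LinearMap.mem_range_self T v⟩).trans (hL' v)
  · refine aux_lsc_lintegral _ F hF _ ?_
    intro g hg hgt hgF
    have hgc : Continuous fun y => (g y).toReal :=
      ENNReal.continuousOn_toReal.comp_continuous hg (fun y => hgt y)
    let G : C_c(Y, ℝ) := ⟨⟨fun y => (g y).toReal, hgc⟩, HasCompactSupport.of_compactSpace _⟩
    have hGp : p G ≤ 1 := csInf_le (hDbdd _) ⟨one_pos, fun y => by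
      have : G y = (g y).toReal := rfl
      rw [this, ENNReal.ofReal_toReal (hgt y)]
      simpa using hgF y⟩
    have h1 : ∫ y, (g y).toReal ∂(RealRMK.rieszMeasure P) ≤ C := by
      have h2 : ∫ y, G y ∂(RealRMK.rieszMeasure P) = Λ G := RealRMK.integral_rieszMeasure P G
      have h3 : Λ G ≤ C * p G := hΛN G
      have h4 : C * p G ≤ C := by
        have := mul_le_mul_of_nonneg_left hGp hC
        linarith
      exact (h2.le.trans h3).trans h4
    have hintg : Integrable (fun y => (g y).toReal) (RealRMK.rieszMeasure P) := 
      hgc.integrable_of_hasCompactSupport (HasCompactSupport.of_compactSpace _)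
    have h5 := ofReal_integral_eq_lintegral_ofReal hintg (Eventually.of_forall fun y => by simp)
    simp_rw [ENNReal.ofReal_toReal (hgt _)] at h5
    rw [← h5]
    exact ENNReal.ofReal_le_ofReal h1

lemma aux_psd {d : ℕ} (M : Matd d) : M.PosSemidef ↔ (∀ i j, M j i = M i j) ∧
    ∀ x : Fin d →₀ ℝ, 0 ≤ ∑ i, ∑ j, x i * M i j * x j := by
  have key : ∀ x : Fin d →₀ ℝ, (x.sum fun i xi ↦ x.sum fun j xj ↦ star xi * M i j * xj) =
      ∑ i, ∑ j, x i * M i j * x j := by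
    intro x
    rw [Finsupp.sum_fintype _ _ (by simp)]
    refine Finset.sum_congr rfl fun i _ => ?_
    rw [Finsupp.sum_fintype _ _ (by simp)]
    simp
  unfold Matrix.PosSemidef
  simp_rw [key]
  refine and_congr ?_ Iff.rfl
  rw [Matrix.IsHermitian.ext_iff]
  simp

/-- The positive semidefinite matrices of Frobenius norm one. -/
def auxS (d : ℕ) : Set (Fin d → Fin d → ℝ) :=
  {M | Matrix.PosSemidef (M : Matd d) ∧ frob (M : Matd d) M = 1}

lemma aux_cont_frob {d : ℕ} {Z : Type*} [TopologicalSpace Z] {A B : Z → Matd d}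
    (hA : ∀ i j, Continuous fun z => A z i j) (hB : ∀ i j, Continuous fun z => B z i j) :
    Continuous fun z => frob (A z) (B z) := by
  unfold frob
  fun_prop

lemma auxS_compact (d : ℕ) : IsCompact (auxS d) := by
  have hcont : ∀ i j : Fin d, Continuous fun M : Fin d → Fin d → ℝ => M i j := by
    intro i j; fun_prop
  apply Metric.isCompact_of_isClosed_isBounded
  · have : auxS d = ((⋂ i, ⋂ j, {M | M j i = M i j}) ∩
        ⋂ x : Fin d →₀ ℝ, {M | 0 ≤ ∑ i, ∑ j, x i * M i j * x j}) ∩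
        {M | frob (M : Matd d) M = 1} := by
      ext M
      have h1 : M ∈ auxS d ↔ Matrix.PosSemidef (M : Matd d) ∧ frob (M : Matd d) M = 1 := Iff.rfl
      refine h1.trans ((and_congr (aux_psd (d := d) M) Iff.rfl).trans ?_)
      exact ⟨fun h => ⟨⟨mem_iInter.2 fun i => mem_iInter.2 fun j => h.1.1 i j,
        mem_iInter.2 h.1.2⟩, h.2⟩, fun h => ⟨⟨fun i j => mem_iInter.1 (mem_iInter.1 h.1.1 i) j,
        fun x => mem_iInter.1 h.1.2 x⟩, h.2⟩⟩
    rw [this]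
    refine (IsClosed.inter ?_ ?_).inter ?_
    · exact isClosed_iInter fun i => isClosed_iInter fun j => isClosed_eq (hcont _ _) (hcont _ _)
    · exact isClosed_iInter fun x => isClosed_le continuous_const (by fun_prop)
    · exact isClosed_eq (aux_cont_frob hcont hcont) continuous_const
  · refine (Metric.isBounded_closedBall (x := (0 : Fin d → Fin d → ℝ)) (r := 1)).subset ?_
    intro M hM
    rw [mem_closedBall_zero_iff, pi_norm_le_iff_of_nonneg zero_le_one]
    intro i
    rw [pi_norm_le_iff_of_nonneg zero_le_one]
    intro j
    have h1 : frob (M : Matd d) M = 1 := hM.2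
    have h2 : M i j * M i j ≤ frob (M : Matd d) M := by
      unfold frob
      refine le_trans ?_ (Finset.single_le_sum (f := fun i => ∑ j, M i j * M i j)
        (fun i _ => Finset.sum_nonneg fun j _ => mul_self_nonneg _) (Finset.mem_univ i))
      exact Finset.single_le_sum (f := fun j => M i j * M i j)
        (fun j _ => mul_self_nonneg _) (Finset.mem_univ j)
    rw [Real.norm_eq_abs]
    exact abs_le_one_iff_mul_self_le_one.2 (by linarith)

lemma auxS_nonempty {d : ℕ} (hd : 0 < d) : (auxS d).Nonempty := by
  refine ⟨Matrix.diagonal (Pi.single ⟨0, hd⟩ 1), ?_, ?_⟩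
  · exact Matrix.PosSemidef.diagonal (by simp)
  · simp [frob, Matrix.diagonal_apply, Pi.single_apply]

lemma aux_frob_smul {d : ℕ} (t : ℝ) (A B : Matd d) : frob A (t • B) = t * frob A B := by
  simp only [frob, Finset.mul_sum, Matrix.smul_apply, smul_eq_mul]
  refine Finset.sum_congr rfl fun i _ => Finset.sum_congr rfl fun j _ => by ring

lemma aux_frob_smul' {d : ℕ} (t : ℝ) (A B : Matd d) : frob (t • A) B = t * frob A B := by
  simp only [frob, Finset.mul_sum, Matrix.smul_apply, smul_eq_mul]
  refine Finset.sum_congr rfl fun i _ => Finset.sum_congr rfl fun j _ => by ring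

lemma aux_frob_add {d : ℕ} (A A' B : Matd d) : frob (A + A') B = frob A B + frob A' B := by
  simp only [frob, Matrix.add_apply, add_mul, Finset.sum_add_distrib]

/-- Extend a bound from the unit sphere to the whole cone by homogeneity. -/
lemma aux_ext {d : ℕ} {f : Matd d → ℝ≥0∞} (hA1 : CostA1 f) (A : Matd d) (t : ℝ)
    (h : ∀ M ∈ auxS d, ENNReal.ofReal ((1/2 : ℝ) * frob A M) ≤ ENNReal.ofReal t * f M)
    (M : Matd d) (hM : M.PosSemidef) :
    ENNReal.ofReal ((1/2 : ℝ) * frob A M) ≤ ENNReal.ofReal t * f M := by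
  have hnn : 0 ≤ frob M M :=
    Finset.sum_nonneg fun i _ => Finset.sum_nonneg fun j _ => mul_self_nonneg _
  rcases hnn.eq_or_lt with h0 | h0
  · have hz : M = 0 := by
      ext i j
      have h1 := (Finset.sum_eq_zero_iff_of_nonneg (fun i _ =>
        Finset.sum_nonneg fun j _ => mul_self_nonneg (M i j))).1 h0.symm i (Finset.mem_univ i)
      have h2 := (Finset.sum_eq_zero_iff_of_nonneg (fun j _ =>
        mul_self_nonneg (M i j))).1 h1 j (Finset.mem_univ j)
      simpa using h2
    simp [hz, frob]
  · set s := Real.sqrt (frob M M) with hs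
    have hspos : 0 < s := Real.sqrt_pos.2 h0
    have hMs : M = s • (s⁻¹ • M) := by rw [smul_smul, mul_inv_cancel₀ hspos.ne', one_smul]
    have hmem : (s⁻¹ • M) ∈ auxS d := by
      refine ⟨hM.smul (inv_nonneg.2 hspos.le), ?_⟩
      have hss : s * s = frob M M := Real.mul_self_sqrt hnn
      have : frob (s⁻¹ • M) (s⁻¹ • M) = 1 := by
        rw [aux_frob_smul, aux_frob_smul', ← hss]
        field_simp
      exact this
    have h1 := h _ hmem
    rw [hMs, aux_frob_smul, hA1.2.2.2 s hspos.le]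
    calc ENNReal.ofReal ((1/2 : ℝ) * (s * frob A (s⁻¹ • M)))
        = ENNReal.ofReal s * ENNReal.ofReal ((1/2 : ℝ) * frob A (s⁻¹ • M)) := by
          rw [← ENNReal.ofReal_mul hspos.le]; congr 1; ring
      _ ≤ ENNReal.ofReal s * (ENNReal.ofReal t * f (s⁻¹ • M)) := by gcongr
      _ = _ := by ring

/-- Weak duality for the static problem. -/
lemma aux_weak {d : ℕ} {f : Matd d → ℝ≥0∞} (hA1 : CostA1 f) (X : Set (Ed d))
    (μ ν : Measure (Ed d)) (φ : Ed d → ℝ) (hφ : IsC2c φ) (t : ℝ) (ht : 0 < t)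
    (h : ∀ x ∈ X, ∀ M ∈ auxS d,
      ENNReal.ofReal ((1/2 : ℝ) * frob (hess φ x) M) ≤ ENNReal.ofReal t * f M) :
    ENNReal.ofReal (∫ x, φ x ∂ν - ∫ x, φ x ∂μ) ≤ ENNReal.ofReal t * Fstat f X μ ν := by
  have ht0 : ENNReal.ofReal t ≠ 0 := by simpa using ht
  rw [mul_comm, ← ENNReal.div_le_iff ht0 ENNReal.ofReal_ne_top]
  refine le_sInf ?_
  rintro c ⟨m, ρ, ⟨hm, hmX, hρ, hφm⟩, rfl⟩
  rw [ENNReal.div_le_iff ht0 ENNReal.ofReal_ne_top, mul_comm, ← hφm φ hφ,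
    ← lintegral_const_mul' _ _ ENNReal.ofReal_ne_top]
  have h1 : ENNReal.ofReal (∫ x, (1/2 : ℝ) * frob (hess φ x) (ρ x) ∂m) ≤
      ∫⁻ x, ENNReal.ofReal ((1/2 : ℝ) * frob (hess φ x) (ρ x)) ∂m := by
    by_cases hi : Integrable (fun x => (1/2 : ℝ) * frob (hess φ x) (ρ x)) m
    · rw [integral_eq_lintegral_pos_part_sub_lintegral_neg_part hi]
      refine (ENNReal.ofReal_le_ofReal (sub_le_self _ ENNReal.toReal_nonneg)).trans ?_
      exact ENNReal.ofReal_toReal_le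
    · rw [integral_undef hi]; simp
  refine h1.trans (lintegral_mono_ae ?_)
  have hae : ∀ᵐ x ∂m, x ∈ X := by rw [ae_iff]; exact hmX
  filter_upwards [hae] with x hx
  exact aux_ext hA1 _ t (h x hx) _ (hρ x)

/-- Weak duality integrated along a transport kernel. -/
lemma aux_weak_H {d : ℕ} {f : Matd d → ℝ≥0∞} (hA1 : CostA1 f) (X : Set (Ed d))
    (μ ν : Measure (Ed d)) [IsFiniteMeasure μ] [IsFiniteMeasure ν] (κ : Ed d → Measure (Ed d))
    (hκ : IsTransportKernel X μ ν κ) (φ : Ed d → ℝ) (hφ : IsC2c φ) (t : ℝ) (ht : 0 < t)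
    (h : ∀ x ∈ X, ∀ M ∈ auxS d,
      ENNReal.ofReal ((1/2 : ℝ) * frob (hess φ x) M) ≤ ENNReal.ofReal t * f M) :
    ENNReal.ofReal (∫ x, φ x ∂ν - ∫ x, φ x ∂μ) ≤
      ENNReal.ofReal t * ∫⁻ x, Gcost f X x (κ x) ∂μ := by
  obtain ⟨hκ1, hκ2, hκ3⟩ := hκ
  have hκm : Measurable κ := Measure.measurable_of_measurable_coe _ hκ2
  let K : ProbabilityTheory.Kernel (Ed d) (Ed d) := ⟨κ, hκm⟩
  have hKp : ProbabilityTheory.IsMarkovKernel K := ⟨fun x => (hκ1 x).1⟩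
  have hν : ν = (μ.compProd K).map Prod.snd := by
    ext A hA
    rw [Measure.map_apply measurable_snd hA, Measure.compProd_apply (measurable_snd hA),
      ← hκ3 A hA]
    rfl
  have hφi : ∀ (τ : Measure (Ed d)) [IsFiniteMeasure τ], Integrable φ τ := fun τ _ =>
    hφ.1.continuous.integrable_of_hasCompactSupport hφ.2
  have hi2 : Integrable (fun z : Ed d × Ed d => φ z.2) (μ.compProd K) := by
    have := hφi ν
    rw [hν] at this
    exact this.comp_measurable measurable_snd
  have hintg : ∫ x, φ x ∂ν = ∫ x, ∫ y, φ y ∂(κ x) ∂μ := by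
    have h1 : ∫ x, φ x ∂ν = ∫ z, φ z.2 ∂(μ.compProd K) := by
      conv_lhs => rw [hν]
      rw [integral_map measurable_snd.aemeasurable
        hφ.1.continuous.aestronglyMeasurable]
    rw [h1, Measure.integral_compProd hi2]
    rfl
  have hi3 : Integrable (fun x => ∫ y, φ y ∂(κ x)) μ := 
    Integrable.integral_compProd (κ := ProbabilityTheory.Kernel.const Unit μ)
      (η := ProbabilityTheory.Kernel.prodMkLeft Unit K) (a := ()) hi2
  rw [hintg, ← integral_sub hi3 (hφi μ), ← lintegral_const_mul' _ _ ENNReal.ofReal_ne_top]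
  have hi4 := hi3.sub (hφi μ)
  calc ENNReal.ofReal (∫ x, (∫ y, φ y ∂(κ x) - φ x) ∂μ)
      ≤ ∫⁻ x, ENNReal.ofReal (∫ y, φ y ∂(κ x) - φ x) ∂μ := by
        have hi5 : Integrable (fun x => ∫ y, φ y ∂(κ x) - φ x) μ := hi4
        rw [integral_eq_lintegral_pos_part_sub_lintegral_neg_part hi5]
        refine (ENNReal.ofReal_le_ofReal (sub_le_self _ ENNReal.toReal_nonneg)).trans ?_
        exact ENNReal.ofReal_toReal_le
    _ ≤ _ := by
        refine lintegral_mono fun x => ?_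
        have := aux_weak hA1 X (Measure.dirac x) (κ x) φ hφ t ht h
        rwa [integral_dirac] at this

/-- The vector space `C²_c(ℝ^d)`. -/
def auxV (d : ℕ) : Submodule ℝ (Ed d → ℝ) where
  carrier := {φ | IsC2c φ}
  add_mem' := by
    intro φ ψ hφ hψ
    exact ⟨hφ.1.add hψ.1, hφ.2.add hψ.2⟩
  zero_mem' := ⟨contDiff_const, HasCompactSupport.zero⟩
  smul_mem' := by
    intro a φ hφ
    exact ⟨contDiff_const.smul hφ.1, hφ.2.smul_left (f := fun _ => a)⟩

lemma aux_hess_add {d : ℕ} {φ ψ : Ed d → ℝ} (hφ : IsC2c φ) (hψ : IsC2c ψ) (x : Ed d) :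
    hess (φ + ψ) x = hess φ x + hess ψ x := by
  ext i j
  simp only [hess, Matrix.add_apply]
  rw [iteratedFDeriv_add_apply hφ.1.contDiffAt hψ.1.contDiffAt]
  rfl

lemma aux_hess_smul {d : ℕ} {φ : Ed d → ℝ} (a : ℝ) (hφ : IsC2c φ) (x : Ed d) :
    hess (a • φ) x = a • hess φ x := by
  ext i j
  simp only [hess, Matrix.smul_apply]
  rw [iteratedFDeriv_const_smul_apply hφ.1.contDiffAt]
  rfl

lemma aux_hess_cont {d : ℕ} {φ : Ed d → ℝ} (hφ : IsC2c φ) (i j : Fin d) :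
    Continuous fun x => hess φ x i j := by
  have := hφ.1.continuous_iteratedFDeriv (m := 2) le_rfl
  simp only [hess]
  exact (ContinuousMultilinearMap.apply ℝ (fun _ : Fin 2 => Ed d) ℝ
    ![EuclideanSpace.single i 1, EuclideanSpace.single j 1]).continuous.comp this

lemma aux_T_cont {d : ℕ} {φ : Ed d → ℝ} (hφ : IsC2c φ) :
    Continuous fun z : Ed d × auxS d => (1/2 : ℝ) * frob (hess φ z.1) (z.2 : Fin d → Fin d → ℝ) := by
  refine continuous_const.mul (aux_cont_frob (fun i j => (aux_hess_cont hφ i j).comp continuous_fst)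
    fun i j => ?_)
  have : Continuous fun z : Ed d × auxS d => (z.2 : Fin d → Fin d → ℝ) :=
    continuous_subtype_val.comp continuous_snd
  exact (continuous_apply j).comp ((continuous_apply i).comp this)

/-- The function `(x, M) ↦ ½ ∇²φ(x) : M`. -/
noncomputable def auxTf {d : ℕ} (X : Set (Ed d)) (φ : Ed d → ℝ) (z : X × auxS d) : ℝ :=
  (1/2 : ℝ) * frob (hess φ z.1) (z.2 : Fin d → Fin d → ℝ)

lemma auxTf_cont {d : ℕ} (X : Set (Ed d)) {φ : Ed d → ℝ} (hφ : IsC2c φ) :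
    Continuous (auxTf X φ) := by
  unfold auxTf
  refine continuous_const.mul (aux_cont_frob (fun i j => (aux_hess_cont hφ i j).comp
    (continuous_subtype_val.comp continuous_fst)) fun i j => ?_)
  have : Continuous fun z : X × auxS d => (z.2 : Fin d → Fin d → ℝ) :=
    continuous_subtype_val.comp continuous_snd
  exact (continuous_apply j).comp ((continuous_apply i).comp this)

lemma auxTf_add {d : ℕ} (X : Set (Ed d)) {φ ψ : Ed d → ℝ} (hφ : IsC2c φ) (hψ : IsC2c ψ)
    (z : X × auxS d) : auxTf X (φ + ψ) z = auxTf X φ z + auxTf X ψ z := by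
  unfold auxTf
  have := aux_frob_add (hess φ z.1) (hess ψ z.1) (z.2 : Fin d → Fin d → ℝ)
  rw [aux_hess_add hφ hψ]
  linear_combination (1/2 : ℝ) * this

lemma auxTf_smul {d : ℕ} (X : Set (Ed d)) {φ : Ed d → ℝ} (a : ℝ) (hφ : IsC2c φ)
    (z : X × auxS d) : auxTf X (a • φ) z = a * auxTf X φ z := by
  unfold auxTf
  have := aux_frob_smul' a (hess φ z.1) (z.2 : Fin d → Fin d → ℝ)
  rw [aux_hess_smul a hφ]
  linear_combination (1/2 : ℝ) * this

open CompactlySupported in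
/-- The operator sending `φ` to `(x, M) ↦ ½ ∇²φ(x) : M`. -/
noncomputable def auxT (d : ℕ) (X : Set (Ed d)) [CompactSpace X] [CompactSpace (auxS d)] :
    auxV d →ₗ[ℝ] C_c(X × auxS d, ℝ) where
  toFun φ := ⟨⟨auxTf X φ.1, auxTf_cont X φ.2⟩, HasCompactSupport.of_compactSpace _⟩
  map_add' φ ψ := by
    ext z
    exact auxTf_add X φ.2 ψ.2 z
  map_smul' a φ := by
    ext z
    exact auxTf_smul X a φ.2 z

/-- The functional `φ ↦ ∫ φ dν - ∫ φ dμ`. -/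
noncomputable def auxL (d : ℕ) (μ ν : Measure (Ed d)) [IsFiniteMeasure μ] [IsFiniteMeasure ν] :
    auxV d →ₗ[ℝ] ℝ where
  toFun φ := ∫ x, φ.1 x ∂ν - ∫ x, φ.1 x ∂μ
  map_add' φ ψ := by
    have hi : ∀ (χ : auxV d) (τ : Measure (Ed d)) [IsFiniteMeasure τ], Integrable χ.1 τ :=
      fun χ τ _ => χ.2.1.continuous.integrable_of_hasCompactSupport χ.2.2
    have h1 : ∀ (τ : Measure (Ed d)) [IsFiniteMeasure τ],
        ∫ x, (φ + ψ).1 x ∂τ = ∫ x, φ.1 x ∂τ + ∫ x, ψ.1 x ∂τ :=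
      fun τ _ => integral_add (hi φ τ) (hi ψ τ)
    rw [h1, h1]
    ring
  map_smul' a φ := by
    have h1 : ∀ (τ : Measure (Ed d)), ∫ x, (a • φ).1 x ∂τ = a * ∫ x, φ.1 x ∂τ :=
      fun τ => integral_const_mul a _
    rw [h1, h1]
    simp only [RingHom.id_apply, smul_eq_mul]
    ring

/-- From a measure on `X × S` to a competitor. -/
lemma aux_bary {d : ℕ} (hd : 0 < d) {f : Matd d → ℝ≥0∞} (hA1 : CostA1 f) (hA2 : CostA2 f)
    (X : Set (Ed d)) (hX : IsClosed X) (μ ν : Measure (Ed d)) (θ : Measure (X × auxS d))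
    [IsFiniteMeasure θ]
    (hθ : ∀ φ : Ed d → ℝ, IsC2c φ →
      ∫ z, (1/2 : ℝ) * frob (hess φ z.1) (z.2 : Fin d → Fin d → ℝ) ∂θ
        = ∫ x, φ x ∂ν - ∫ x, φ x ∂μ) :
    Fstat f X μ ν ≤ ∫⁻ z, f (z.2 : Fin d → Fin d → ℝ) ∂θ := by
  have hne : Nonempty (auxS d) := (auxS_nonempty hd).to_subtype
  have hScl : IsClosed (auxS d) := (auxS_compact d).isClosed
  have hStd : StandardBorelSpace (auxS d) := hScl.measurableSet.standardBorel
  have hcomp : CompactSpace (auxS d) := isCompact_iff_compactSpace.1 (auxS_compact d)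
  let ι : X × auxS d → Ed d × auxS d := Prod.map Subtype.val id
  have hι : Measurable ι := measurable_subtype_coe.prodMap measurable_id
  let η : Measure (Ed d × auxS d) := θ.map ι
  have hηf : IsFiniteMeasure η := Measure.isFiniteMeasure_map θ ι
  let ρ₀ : Ed d → Fin d → Fin d → ℝ := fun x => ∫ M, (M : Fin d → Fin d → ℝ) ∂(η.condKernel x)
  let ρ : Ed d → Matd d := ρ₀
  have hvalc : Continuous fun M : auxS d => (M : Fin d → Fin d → ℝ) := continuous_subtype_val
  have hvali : ∀ x, Integrable (fun M : auxS d => (M : Fin d → Fin d → ℝ)) (η.condKernel x) :=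
    fun x => hvalc.integrable_of_hasCompactSupport (HasCompactSupport.of_compactSpace _)
  have hvali' : ∀ x i, Integrable (fun M : auxS d => (M : Fin d → Fin d → ℝ) i)
      (η.condKernel x) := fun x i =>
    ((continuous_apply i).comp hvalc).integrable_of_hasCompactSupport
      (HasCompactSupport.of_compactSpace _)
  have hvali'' : ∀ x i j, Integrable (fun M : auxS d => (M : Fin d → Fin d → ℝ) i j)
      (η.condKernel x) := fun x i j =>
    ((continuous_apply j).comp ((continuous_apply i).comp hvalc)).integrable_of_hasCompactSupport
      (HasCompactSupport.of_compactSpace _)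
  have hρij : ∀ x i j, ρ x i j = ∫ M, (M : Fin d → Fin d → ℝ) i j ∂(η.condKernel x) := by
    intro x i j
    have h1 : (∫ M, (M : Fin d → Fin d → ℝ) ∂(η.condKernel x)) i
        = ∫ M, (M : Fin d → Fin d → ℝ) i ∂(η.condKernel x) := eval_integral (hvali' x) i
    have h2 : (∫ M, (M : Fin d → Fin d → ℝ) i ∂(η.condKernel x)) j
        = ∫ M, (M : Fin d → Fin d → ℝ) i j ∂(η.condKernel x) := eval_integral (hvali'' x i) j
    rw [← h2, ← h1]
  have hlin : ∀ (x : Ed d) (a : Fin d → Fin d → ℝ), ∑ i, ∑ j, a i j * ρ x i j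
      = ∫ M, ∑ i, ∑ j, a i j * (M : Fin d → Fin d → ℝ) i j ∂(η.condKernel x) := by
    intro x a
    rw [integral_finsetSum _ fun i _ => integrable_finsetSum _ fun j _ =>
      (hvali'' x i j).const_mul _]
    refine Finset.sum_congr rfl fun i _ => ?_
    rw [integral_finsetSum _ fun j _ => (hvali'' x i j).const_mul _]
    refine Finset.sum_congr rfl fun j _ => ?_
    rw [integral_const_mul, hρij]
  have hA2' : LowerSemicontinuous f := hA2
  have hfv : Measurable fun M : auxS d => f (M : Fin d → Fin d → ℝ) :=
    (hA2'.comp (g := fun M : auxS d => ((M : Fin d → Fin d → ℝ) : Matd d)) hvalc).measurable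
  refine sInf_le_of_le ⟨η.fst, ρ, ⟨inferInstance, ?_, ?_, ?_⟩, rfl⟩ ?_
  · rw [Measure.fst_apply hX.measurableSet.compl, Measure.map_apply hι
      (measurable_fst hX.measurableSet.compl)]
    convert measure_empty (μ := θ)
    ext z
    simp [ι]
  · intro x
    rw [aux_psd]
    refine ⟨fun i j => ?_, fun v => ?_⟩
    · rw [hρij, hρij]
      refine integral_congr_ae (Eventually.of_forall fun M => ?_)
      exact ((aux_psd _).1 M.2.1).1 i j
    · have h1 := hlin x (fun i j => v i * v j)
      have h2 : ∑ i, ∑ j, v i * ρ x i j * v j = ∑ i, ∑ j, v i * v j * ρ x i j :=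
        Finset.sum_congr rfl fun i _ => Finset.sum_congr rfl fun j _ => by ring
      rw [h2, h1]
      refine integral_nonneg fun M => ?_
      have h3 := ((aux_psd _).1 M.2.1).2 v
      refine h3.trans_eq ?_
      exact Finset.sum_congr rfl fun i _ => Finset.sum_congr rfl fun j _ => by ring
  · intro φ hφ
    have hTc := aux_T_cont hφ
    have hTi : Integrable (fun z : Ed d × auxS d =>
        (1/2 : ℝ) * frob (hess φ z.1) (z.2 : Fin d → Fin d → ℝ)) η := by
      refine hTc.integrable_of_hasCompactSupport ?_
      refine HasCompactSupport.of_support_subset_isCompact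
        (hφ.2.isCompact.prod (isCompact_univ (X := auxS d))) ?_
      intro z hz
      refine ⟨?_, mem_univ _⟩
      by_contra hcon
      apply hz
      have h0 : iteratedFDeriv ℝ 2 φ z.1 = 0 := by
        by_contra h00
        exact hcon (support_iteratedFDeriv_subset 2 h00)
      simp [hess, h0, frob]
    have h1 : ∀ x, (1/2 : ℝ) * frob (hess φ x) (ρ x) =
        ∫ M, (1/2 : ℝ) * frob (hess φ x) (M : Fin d → Fin d → ℝ) ∂(η.condKernel x) := by
      intro x
      rw [integral_const_mul]
      congr 1
      exact hlin x _
    simp_rw [h1]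
    rw [Measure.integral_condKernel hTi, integral_map hι.aemeasurable hTc.aestronglyMeasurable]
    exact hθ φ hφ
  · calc ∫⁻ x, f (ρ x) ∂η.fst
        ≤ ∫⁻ x, ∫⁻ M, f (M : Fin d → Fin d → ℝ) ∂(η.condKernel x) ∂η.fst := by
          refine lintegral_mono fun x => ?_
          exact aux_jensen (E := Fin d → Fin d → ℝ) f hA1.2.2.1 hA1.2.2.2 hA2 (η.condKernel x)
            (fun M : auxS d => (M : Fin d → Fin d → ℝ)) (hvali x) hfv
      _ = ∫⁻ z, f (z.2 : Fin d → Fin d → ℝ) ∂η :=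
          Measure.lintegral_condKernel
            (f := fun z : Ed d × auxS d => f (z.2 : Fin d → Fin d → ℝ)) (hfv.comp measurable_snd)
      _ = ∫⁻ z, f (z.2 : Fin d → Fin d → ℝ) ∂θ :=
          lintegral_map (f := fun z : Ed d × auxS d => f (z.2 : Fin d → Fin d → ℝ))
            (hfv.comp measurable_snd) hι

/-- The inequality for positive finite measures. -/
lemma aux_main {d : ℕ} (hd : 0 < d) {f : Matd d → ℝ≥0∞} (hA1 : CostA1 f) (hA2 : CostA2 f)
    (X : Set (Ed d)) (hX : IsCompact X) (μ ν : Measure (Ed d)) [IsFiniteMeasure μ]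
    [IsFiniteMeasure ν] : Fstat f X μ ν ≤ Hcost f X μ ν := by
  refine le_sInf ?_
  rintro C ⟨κ, hκ, hC⟩
  by_cases hCt : C = ⊤
  · rw [hCt]; exact le_top
  have hcX : CompactSpace X := isCompact_iff_compactSpace.1 hX
  have hcS : CompactSpace (auxS d) := isCompact_iff_compactSpace.1 (auxS_compact d)
  obtain ⟨c, hc, hcf⟩ := hA1.2.1
  have hA2' : LowerSemicontinuous f := hA2
  have hlsc : LowerSemicontinuous fun z : X × auxS d => f (z.2 : Fin d → Fin d → ℝ) :=
    hA2'.comp (g := fun z : X × auxS d => ((z.2 : Fin d → Fin d → ℝ) : Matd d))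
      (continuous_subtype_val.comp continuous_snd)
  obtain ⟨θ, hθf, hθ, hθc⟩ := aux_duality
    (fun z : X × auxS d => f (z.2 : Fin d → Fin d → ℝ)) hlsc c hc
    (by
      intro z
      have h1 := hcf (z.2 : Fin d → Fin d → ℝ)
      have h2 : matnorm ((z.2 : Fin d → Fin d → ℝ) : Matd d) = 1 := by
        unfold matnorm
        rw [z.2.2.2, Real.sqrt_one]
      rwa [h2, mul_one] at h1)
    (auxT d X) (auxL d μ ν) C.toReal ENNReal.toReal_nonneg
    (by
      intro φ t ht hb
      have h1 := aux_weak_H hA1 X μ ν κ hκ φ.1 φ.2 t ht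
        (fun x hx M hM => hb (⟨x, hx⟩, ⟨M, hM⟩))
      rw [← hC, ← ENNReal.ofReal_toReal hCt, ← ENNReal.ofReal_mul ht.le] at h1
      exact (ENNReal.ofReal_le_ofReal_iff (by positivity)).1 h1)
  rw [ENNReal.ofReal_toReal hCt] at hθc
  exact (aux_bary hd hA1 hA2 X hX.isClosed μ ν θ (fun φ hφ => hθ ⟨φ, hφ⟩)).trans hθc

/-- Proposition 3.12. For every `μ, ν ∈ M(X)`, `H(μ,ν) ≥ F(μ,ν)`. -/
theorem stmt8 {d : ℕ} (hd : 0 < d) (f : Matd d → ℝ≥0∞) (hA1 : CostA1 f) (hA2 : CostA2 f)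
    (Ω X : Set (Ed d)) (hΩopen : IsOpen Ω) (hΩconv : Convex ℝ Ω)
    (hΩbdd : Bornology.IsBounded Ω) (hΩne : Ω.Nonempty) (hX : X = closure Ω)
    (μ ν : SignedMeasure (Ed d)) (hμ : SuppInX X μ) (hν : SuppInX X ν) :
    FSgn f X μ ν ≤ HSgn f X μ ν := by
  unfold FSgn HSgn
  split_ifs with h
  · have hXc : IsCompact X := by
      rw [hX]
      exact hΩbdd.isCompact_closure
    exact aux_main hd hA1 hA2 X hXc _ _
  · exact le_rfl
end

section
/- If ψ ∈ C²_c(ℝ^d) and ½∇²ψ(x) ∈ dom(f*) for all x ∈ X, then −ψ = (−ψ)^G on X. Conversely, if ψ ∈ C²_c(ℝ^d) and −ψ = (−ψ)^G on Ω, then ½∇²ψ(x) ∈ dom(f*) for all x ∈ X. -/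
open MeasureTheory Set Filter Topology
open scoped ENNReal NNReal Classical

namespace Prop41

/-- profile `w(z) = 4 (1-|z|²)₊` -/
noncomputable def wF {d : ℕ} (z : Ed d) : ℝ := 4 * max 0 (1 - ‖z‖ ^ 2)

/-- profile `h(z) = ((1-|z|²)₊)²` -/
noncomputable def hF {d : ℕ} (z : Ed d) : ℝ := (max 0 (1 - ‖z‖ ^ 2)) ^ 2

lemma wF_cont {d : ℕ} : Continuous (wF (d := d)) := by unfold wF; fun_prop
lemma hF_cont {d : ℕ} : Continuous (hF (d := d)) := by unfold hF; fun_prop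
lemma wF_nonneg {d : ℕ} (z : Ed d) : 0 ≤ wF z := by unfold wF; positivity
lemma hF_nonneg {d : ℕ} (z : Ed d) : 0 ≤ hF z := by unfold hF; positivity

lemma max_zero_of_norm {d : ℕ} {z : Ed d} (hz : 1 < ‖z‖) : max 0 (1 - ‖z‖ ^ 2) = 0 := by
  apply max_eq_left
  nlinarith

lemma wF_supp {d : ℕ} {z : Ed d} (hz : 1 < ‖z‖) : wF z = 0 := by
  unfold wF; rw [max_zero_of_norm hz]; simp
lemma hF_supp {d : ℕ} {z : Ed d} (hz : 1 < ‖z‖) : hF z = 0 := by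
  unfold hF; rw [max_zero_of_norm hz]; simp

lemma hcs_of {d : ℕ} {g : Ed d → ℝ} (hg : ∀ z, 1 < ‖z‖ → g z = 0) : HasCompactSupport g := by
  apply HasCompactSupport.intro (isCompact_closedBall (0 : Ed d) 1)
  intro z hz
  apply hg
  simpa using hz

lemma int_of {d : ℕ} {g : Ed d → ℝ} (hc : Continuous g) (hg : ∀ z, 1 < ‖z‖ → g z = 0) :
    Integrable g := hc.integrable_of_hasCompactSupport (hcs_of hg)

lemma wF_pos {d : ℕ} : 0 < ∫ z : Ed d, wF z := by
  apply Continuous.integral_pos_of_hasCompactSupport_nonneg_nonzero (x := 0) wF_cont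
    (hcs_of fun z hz => wF_supp hz) wF_nonneg
  simp [wF]

lemma hF_pos {d : ℕ} : 0 < ∫ z : Ed d, hF z := by
  apply Continuous.integral_pos_of_hasCompactSupport_nonneg_nonzero (x := 0) hF_cont
    (hcs_of fun z hz => hF_supp hz) hF_nonneg
  simp [hF]

lemma hasDerivAt_maxsq (t : ℝ) : HasDerivAt (fun t : ℝ => (max 0 t) ^ 2) (2 * max 0 t) t := by
  rcases lt_trichotomy t 0 with h | h | h
  · have : (fun t : ℝ => (max 0 t) ^ 2) =ᶠ[𝓝 t] fun _ => 0 := by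
      filter_upwards [gt_mem_nhds h] with s hs
      simp [max_eq_left hs.le]
    rw [max_eq_left h.le]
    simpa using (hasDerivAt_const t (0:ℝ)).congr_of_eventuallyEq this
  · subst h
    rw [hasDerivAt_iff_isLittleO_nhds_zero]
    simp only [zero_add, max_self, mul_zero, smul_zero, sub_zero]
    have : (fun h : ℝ => h ^ 2) =o[𝓝 0] fun h : ℝ => h := by
      simpa using Asymptotics.isLittleO_pow_id (𝕜 := ℝ) (n := 2) (by norm_num)
    refine Asymptotics.IsBigO.trans_isLittleO ?_ this
    refine Asymptotics.IsBigO.of_bound 1 (Eventually.of_forall fun s => ?_)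
    simp only [ne_eq, OfNat.ofNat_ne_zero, not_false_eq_true, zero_pow, sub_zero, norm_pow, one_mul]
    gcongr
    rw [Real.norm_eq_abs, Real.norm_eq_abs, abs_of_nonneg (le_max_left 0 s)]
    exact max_le (abs_nonneg s) (le_abs_self s)
  · have : (fun t : ℝ => (max 0 t) ^ 2) =ᶠ[𝓝 t] fun t => t ^ 2 := by
      filter_upwards [lt_mem_nhds h] with s hs
      simp [max_eq_right hs.le]
    rw [max_eq_right h.le]
    simpa using (hasDerivAt_pow 2 t).congr_of_eventuallyEq this

lemma hF_hasFDerivAt {d : ℕ} (z : Ed d) :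
    HasFDerivAt (hF (d := d)) (-(wF z) • innerSL ℝ z) z := by
  have h1 : HasFDerivAt (fun z : Ed d => 1 - ‖z‖ ^ 2) (-(2 • innerSL ℝ z)) z :=
    ((hasStrictFDerivAt_norm_sq z).hasFDerivAt).const_sub 1
  have h2 := (hasDerivAt_maxsq (1 - ‖z‖ ^ 2)).comp_hasFDerivAt z h1
  refine h2.congr_fderiv ?_
  ext y
  simp [wF]
  ring

lemma hF_fderiv {d : ℕ} (z : Ed d) (k : Fin d) :
    fderiv ℝ (hF (d := d)) z (EuclideanSpace.single k 1) = -(wF z * z k) := by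
  rw [(hF_hasFDerivAt z).fderiv]
  simp [EuclideanSpace.inner_single_right]

/-- the linear map `z ↦ ∑ z_k v_k`. -/
noncomputable def Lmap {d : ℕ} (v : Fin d → Ed d) : Ed d →L[ℝ] Ed d :=
  ∑ k, (EuclideanSpace.proj k : Ed d →L[ℝ] ℝ).smulRight (v k)

lemma Lmap_apply {d : ℕ} (v : Fin d → Ed d) (z : Ed d) : Lmap v z = ∑ k, z k • v k := by
  simp [Lmap]

lemma Lmap_single {d : ℕ} (v : Fin d → Ed d) (k : Fin d) :
    Lmap v (EuclideanSpace.single k 1) = v k := by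
  simp [Lmap_apply]

section
variable {d : ℕ} {φ : Ed d → ℝ}

lemma cont_fd (hφ : ContDiff ℝ 2 φ) : Continuous (fderiv ℝ φ) :=
  hφ.continuous_fderiv (by norm_num)

lemma cd_fd (hφ : ContDiff ℝ 2 φ) : ContDiff ℝ 1 (fderiv ℝ φ) :=
  hφ.fderiv_right (by norm_num)

lemma cont_fd2 (hφ : ContDiff ℝ 2 φ) : Continuous (fderiv ℝ (fderiv ℝ φ)) :=
  (cd_fd hφ).continuous_fderiv (by norm_num)

/-- integration by parts at fixed scale `s` -/
lemma ibp (hφ : ContDiff ℝ 2 φ) (x : Ed d) (v : Fin d → Ed d) (s : ℝ) :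
    ∫ z, fderiv ℝ φ (x + s • Lmap v z) (Lmap v z) * wF z =
      ∫ z, s * hF z * ∑ k, fderiv ℝ (fderiv ℝ φ) (x + s • Lmap v z) (v k) (v k) := by
  have c1 := cont_fd hφ
  have c2 := cont_fd2 hφ
  have hL : Continuous (Lmap v) := (Lmap v).continuous
  have hw := wF_cont (d := d)
  have hh := hF_cont (d := d)
  have e1 : ∀ z, fderiv ℝ φ (x + s • Lmap v z) (Lmap v z) * wF z =
      ∑ k, (wF z * z k) * fderiv ℝ φ (x + s • Lmap v z) (v k) := by
    intro z
    conv_lhs => rw [Lmap_apply v z]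
    rw [map_sum, Finset.sum_mul]
    refine Finset.sum_congr rfl fun k _ => ?_
    rw [map_smul, smul_eq_mul, Lmap_apply]; ring
  have e2 : ∀ z, s * hF z * ∑ k, fderiv ℝ (fderiv ℝ φ) (x + s • Lmap v z) (v k) (v k) =
      ∑ k, hF z * (s * fderiv ℝ (fderiv ℝ φ) (x + s • Lmap v z) (v k) (v k)) := by
    intro z
    rw [Finset.mul_sum]
    refine Finset.sum_congr rfl fun k _ => ?_
    ring
  simp_rw [e1, e2]
  have i1 : ∀ k, Integrable (fun z => (wF z * z k) * fderiv ℝ φ (x + s • Lmap v z) (v k)) := by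
    intro k
    apply int_of
    · fun_prop
    · intro z hz; simp [wF_supp hz]
  have i2 : ∀ k, Integrable (fun z =>
      hF z * (s * fderiv ℝ (fderiv ℝ φ) (x + s • Lmap v z) (v k) (v k))) := by
    intro k
    apply int_of
    · fun_prop
    · intro z hz; simp [hF_supp hz]
  rw [integral_finsetSum _ fun k _ => i1 k, integral_finsetSum _ fun k _ => i2 k]
  refine Finset.sum_congr rfl fun k _ => ?_
  have hg : ∀ z, HasFDerivAt (fun z => fderiv ℝ φ (x + s • Lmap v z) (v k))
      (((ContinuousLinearMap.apply ℝ ℝ (v k)).comp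
        (fderiv ℝ (fderiv ℝ φ) (x + s • Lmap v z))).comp (s • Lmap v)) z := by
    intro z
    have h0 : HasFDerivAt (fun z => x + s • Lmap v z) (s • Lmap v) z :=
      ((Lmap v).hasFDerivAt.const_smul s).const_add x
    have h1 : HasFDerivAt (fderiv ℝ φ) (fderiv ℝ (fderiv ℝ φ) (x + s • Lmap v z))
        (x + s • Lmap v z) :=
      (((cd_fd hφ).differentiable (by norm_num)) _).hasFDerivAt
    have h2 := (ContinuousLinearMap.apply ℝ ℝ (v k)).hasFDerivAt.comp z (h1.comp z h0)
    exact h2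
  have hgd : ∀ z, fderiv ℝ (fun z => fderiv ℝ φ (x + s • Lmap v z) (v k)) z
      (EuclideanSpace.single k 1) =
      s * fderiv ℝ (fderiv ℝ φ) (x + s • Lmap v z) (v k) (v k) := by
    intro z
    rw [(hg z).fderiv]
    simp [Lmap_single]
  have key := integral_mul_fderiv_eq_neg_fderiv_mul_of_integrable (μ := (volume : Measure (Ed d)))
    (f := hF (d := d)) (g := fun z => fderiv ℝ φ (x + s • Lmap v z) (v k))
    (v := EuclideanSpace.single k (1:ℝ)) ?_ ?_ ?_
    (fun z _ => (hF_hasFDerivAt z).differentiableAt) (fun z _ => (hg z).differentiableAt)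
  · simp_rw [hgd, hF_fderiv] at key
    rw [key, ← integral_neg]
    refine integral_congr_ae (Eventually.of_forall fun z => ?_)
    simp only
    ring
  · simp_rw [hF_fderiv]
    refine (i1 k).neg.congr (Eventually.of_forall fun z => ?_)
    simp
  · simp_rw [hgd]; exact i2 k
  · apply int_of
    · fun_prop
    · intro z hz; simp [hF_supp hz]

lemma int_prod_of {g : ℝ × Ed d → ℝ} (hc : Continuous g)
    (hg : ∀ s z, 1 < ‖z‖ → g (s, z) = 0) :
    Integrable g ((volume.restrict (Ioc (0:ℝ) 1)).prod (volume : Measure (Ed d))) := by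
  have h1 : IntegrableOn g (Icc (0:ℝ) 1 ×ˢ Metric.closedBall (0 : Ed d) 1)
      ((volume : Measure ℝ).prod (volume : Measure (Ed d))) :=
    hc.continuousOn.integrableOn_compact (isCompact_Icc.prod (isCompact_closedBall _ _))
  have h2 : IntegrableOn g (Ioc (0:ℝ) 1 ×ˢ univ)
      ((volume : Measure ℝ).prod (volume : Measure (Ed d))) := by
    refine h1.of_forall_sdiff_eq_zero (measurableSet_Ioc.prod MeasurableSet.univ) ?_
    rintro ⟨s, z⟩ ⟨hs, hn⟩
    apply hg
    by_contra hz
    apply hn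
    refine ⟨Ioc_subset_Icc_self hs.1, ?_⟩
    simpa using hz
  rw [IntegrableOn, ← Measure.prod_restrict] at h2
  simpa using h2

lemma core (hφ : ContDiff ℝ 2 φ) (x : Ed d) (v : Fin d → Ed d) :
    ∫ z, (φ (x + Lmap v z) - φ x) * wF z =
      ∫ s in Ioc (0:ℝ) 1, ∫ z, s * hF z *
        ∑ k, fderiv ℝ (fderiv ℝ φ) (x + s • Lmap v z) (v k) (v k) := by
  have c1 := cont_fd hφ
  have hL : Continuous (Lmap v) := (Lmap v).continuous
  have hw := wF_cont (d := d)
  simp_rw [← ibp hφ x v]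
  rw [integral_integral_swap]
  · refine integral_congr_ae (Eventually.of_forall fun z => ?_)
    simp only
    rw [integral_mul_const]
    congr 1
    rw [← intervalIntegral.integral_of_le zero_le_one]
    have hd : ∀ s ∈ uIcc (0:ℝ) 1, HasDerivAt (fun s : ℝ => φ (x + s • Lmap v z))
        (fderiv ℝ φ (x + s • Lmap v z) (Lmap v z)) s := by
      intro s _
      have h0 : HasDerivAt (fun s : ℝ => x + s • Lmap v z) (Lmap v z) s := by
        simpa using ((hasDerivAt_id s).smul_const (Lmap v z)).const_add x
      exact ((hφ.differentiable (by norm_num) _).hasFDerivAt).comp_hasDerivAt s h0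
    rw [intervalIntegral.integral_eq_sub_of_hasDerivAt hd]
    · simp
    · apply Continuous.intervalIntegrable
      fun_prop
  · apply int_prod_of
    · simp only [Function.uncurry_def]
      fun_prop
    · intro s z hz
      simp [wF_supp hz]

end

lemma frob_hess {d : ℕ} (φ : Ed d → ℝ) (y : Ed d) (B : Matd d) :
    frob (hess φ y) (B.transpose * B) =
      ∑ k, fderiv ℝ (fderiv ℝ φ) y (WithLp.toLp 2 (B k)) (WithLp.toLp 2 (B k)) := by
  have hb : ∀ k, (WithLp.toLp 2 (B k) : Ed d) = ∑ i, B k i • EuclideanSpace.single i (1:ℝ) := by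
    intro k
    ext j
    simp [Pi.single_apply]
  have : ∀ k, fderiv ℝ (fderiv ℝ φ) y (WithLp.toLp 2 (B k)) (WithLp.toLp 2 (B k)) =
      ∑ i, ∑ j, B k i * B k j * hess φ y i j := by
    intro k
    rw [hb k]
    simp only [map_sum, map_smul, _root_.sum_apply, _root_.smul_apply,
      smul_eq_mul, hess, iteratedFDeriv_two_apply, Matrix.cons_val_zero, Matrix.cons_val_one,
      Finset.mul_sum]
    rw [Finset.sum_comm]
    refine Finset.sum_congr rfl fun i _ => Finset.sum_congr rfl fun j _ => ?_
    ring
  simp_rw [this]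
  rw [Finset.sum_comm]
  unfold frob
  refine Finset.sum_congr rfl fun i _ => ?_
  rw [Finset.sum_comm]
  refine Finset.sum_congr rfl fun j _ => ?_
  rw [Matrix.mul_apply, Finset.mul_sum]
  refine Finset.sum_congr rfl fun k _ => ?_
  rw [Matrix.transpose_apply]; ring

lemma hess_cont {d : ℕ} {φ : Ed d → ℝ} (hφ : ContDiff ℝ 2 φ) (M : Matd d) :
    Continuous fun y => (1/2 : ℝ) * frob (hess φ y) M := by
  unfold frob hess
  simp only [iteratedFDeriv_two_apply]
  have := cont_fd2 hφ
  fun_prop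

/-- the base density on `(0,1] × ℝ^d` -/
noncomputable def dens {d : ℕ} (C : ℝ) (q : ℝ × Ed d) : ℝ := C * (|q.1| * hF q.2)

lemma dens_cont {d : ℕ} (C : ℝ) : Continuous (dens (d := d) C) := by
  have := hF_cont (d := d)
  unfold dens; fun_prop

lemma dens_nonneg {d : ℕ} {C : ℝ} (hC : 0 ≤ C) (q : ℝ × Ed d) : 0 ≤ dens C q :=
  mul_nonneg hC (mul_nonneg (abs_nonneg _) (hF_nonneg _))

lemma dens_int {d : ℕ} (C : ℝ) : Integrable (dens (d := d) C)
    ((volume.restrict (Ioc (0:ℝ) 1)).prod (volume : Measure (Ed d))) :=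
  int_prod_of (dens_cont C) fun s z hz => by simp [dens, hF_supp hz]

lemma dens_pos {d : ℕ} {C : ℝ} (hC : 0 < C) : 0 < ∫ q, dens (d := d) C q
    ∂((volume.restrict (Ioc (0:ℝ) 1)).prod (volume : Measure (Ed d))) := by
  unfold dens
  rw [integral_const_mul, integral_prod_mul (fun s : ℝ => |s|) (hF (d := d))]
  refine mul_pos hC (mul_pos ?_ hF_pos)
  have : ∫ s in Ioc (0:ℝ) 1, |s| = ∫ s in Ioc (0:ℝ) 1, s :=
    setIntegral_congr_fun measurableSet_Ioc fun s hs => abs_of_pos hs.1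
  rw [this, ← intervalIntegral.integral_of_le zero_le_one]
  simp

lemma competitor {d : ℕ} (x : Ed d) (B : Matd d) {δ : ℝ} (hδ : 0 < δ) :
    ∃ p m : Measure (Ed d), IsProbabilityMeasure p ∧ p (Metric.closedBall x δ)ᶜ = 0 ∧
      IsFiniteMeasure m ∧ m univ ≠ 0 ∧ m (Metric.closedBall x δ)ᶜ = 0 ∧
      ∀ φ : Ed d → ℝ, IsC2c φ → ∫ y, (1/2 : ℝ) * frob (hess φ y) (B.transpose * B) ∂m =
        ∫ y, φ y ∂p - φ x := by
  set b : Fin d → Ed d := fun k => WithLp.toLp 2 (B k) with hb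
  set r : ℝ := δ / (‖Lmap b‖ + 1) with hr
  have hr0 : 0 < r := by positivity
  set v : Fin d → Ed d := fun k => r • b k with hv
  have hLv : ∀ z, Lmap v z = r • Lmap b z := by
    intro z
    rw [Lmap_apply, Lmap_apply, Finset.smul_sum]
    refine Finset.sum_congr rfl fun k _ => ?_
    rw [hv, smul_comm]
  have hLn : ∀ z : Ed d, ‖z‖ ≤ 1 → ‖Lmap v z‖ ≤ δ := by
    intro z hz
    rw [hLv, norm_smul, Real.norm_of_nonneg hr0.le]
    have h1 : ‖Lmap b z‖ ≤ ‖Lmap b‖ + 1 := by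
      calc ‖Lmap b z‖ ≤ ‖Lmap b‖ * ‖z‖ := (Lmap b).le_opNorm z
        _ ≤ ‖Lmap b‖ * 1 := by gcongr
        _ ≤ ‖Lmap b‖ + 1 := by linarith
    calc r * ‖Lmap b z‖ ≤ r * (‖Lmap b‖ + 1) := by gcongr
      _ = δ := by rw [hr]; field_simp
  have hLc : Continuous (Lmap v) := (Lmap v).continuous
  set c : ℝ := (∫ z : Ed d, wF z)⁻¹ with hc
  have hc0 : 0 < c := inv_pos.2 wF_pos
  have hcw : c * ∫ z : Ed d, wF z = 1 := inv_mul_cancel₀ wF_pos.ne'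
  have hwi : Integrable (wF (d := d)) := int_of wF_cont fun z hz => wF_supp hz
  set C : ℝ := 2 * c * r ^ 2 with hC
  have hC0 : 0 < C := by positivity
  set P : Measure (Ed d) := volume.withDensity fun z => ENNReal.ofReal (c * wF z) with hP
  set N : Measure (ℝ × Ed d) := (volume.restrict (Ioc (0:ℝ) 1)).prod (volume : Measure (Ed d))
    with hN
  set Q : Measure (ℝ × Ed d) := N.withDensity fun q => ENNReal.ofReal (dens C q) with hQ
  have mT : Measurable fun z : Ed d => x + Lmap v z := (by fun_prop : Continuous _).measurable
  have mS : Measurable fun q : ℝ × Ed d => x + q.1 • Lmap v q.2 :=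
    (by fun_prop : Continuous _).measurable
  have mw : Measurable fun z : Ed d => ENNReal.ofReal (c * wF z) :=
    (wF_cont.measurable.const_mul c).ennreal_ofReal
  have md : Measurable fun q : ℝ × Ed d => ENNReal.ofReal (dens C q) :=
    (dens_cont C).measurable.ennreal_ofReal
  have hPu : P univ = 1 := by
    rw [hP, withDensity_apply _ MeasurableSet.univ, Measure.restrict_univ,
      ← ofReal_integral_eq_lintegral_ofReal (hwi.const_mul c)
        (Eventually.of_forall fun z => mul_nonneg hc0.le (wF_nonneg z)),
      integral_const_mul, hcw, ENNReal.ofReal_one]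
  have hQu : Q univ = ENNReal.ofReal (∫ q, dens C q ∂N) := by
    rw [hQ, withDensity_apply _ MeasurableSet.univ, Measure.restrict_univ,
      ← ofReal_integral_eq_lintegral_ofReal (dens_int C)
        (Eventually.of_forall fun z => dens_nonneg hC0.le z)]
  have mB : MeasurableSet (Metric.closedBall x δ)ᶜ := Metric.isClosed_closedBall.measurableSet.compl
  haveI : IsProbabilityMeasure P := ⟨hPu⟩
  haveI : IsFiniteMeasure Q := ⟨by rw [hQu]; exact ENNReal.ofReal_lt_top⟩
  refine ⟨P.map fun z => x + Lmap v z, Q.map fun q => x + q.1 • Lmap v q.2,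
    Measure.isProbabilityMeasure_map mT.aemeasurable, ?_, inferInstance, ?_, ?_, ?_⟩
  · rw [Measure.map_apply mT mB, hP, withDensity_apply _ (mT mB)]
    rw [setLIntegral_congr_fun (g := fun _ => 0) (mT mB)]
    · simp
    · intro z hz
      have : 1 < ‖z‖ := by
        by_contra h
        apply hz
        simpa using hLn z (not_lt.1 h)
      simp [wF_supp this]
  · rw [Measure.map_apply mS MeasurableSet.univ, preimage_univ, hQu]
    exact (ENNReal.ofReal_pos.2 (dens_pos hC0)).ne'
  · rw [Measure.map_apply mS mB]
    have h0 : (Ioc (0:ℝ) 1 ×ˢ univ : Set (ℝ × Ed d))ᶜ ⊆ univ := subset_univ _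
    have hNae : ∀ᵐ q ∂N, q.1 ∈ Ioc (0:ℝ) 1 := by
      have h1 : ∀ᵐ s ∂(volume.restrict (Ioc (0:ℝ) 1)), s ∈ Ioc (0:ℝ) 1 :=
        ae_restrict_mem measurableSet_Ioc
      exact Measure.quasiMeasurePreserving_fst.ae h1
    rw [hQ, withDensity_apply _ (mS mB), lintegral_eq_zero_iff md]
    refine (ae_restrict_iff' (mS mB)).2 ?_
    filter_upwards [hNae] with q hq hqB
    have : 1 < ‖q.2‖ := by
      by_contra h
      apply hqB
      have h1 := hLn q.2 (not_lt.1 h)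
      simp only [Metric.mem_closedBall, dist_self_add_left, norm_smul, Real.norm_eq_abs,
        abs_of_pos hq.1]
      calc q.1 * ‖Lmap v q.2‖ ≤ 1 * ‖Lmap v q.2‖ := by gcongr; exact hq.2
        _ ≤ δ := by linarith
    simp [dens, hF_supp this]
  · intro φ hφ
    have hcore := core hφ.1 x v
    have hφc : Continuous φ := hφ.1.continuous
    have hwc := wF_cont (d := d)
    have hHc := hess_cont hφ.1 (B.transpose * B)
    rw [integral_map mS.aemeasurable hHc.aestronglyMeasurable,
      integral_map mT.aemeasurable hφc.aestronglyMeasurable]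
    rw [hQ, integral_withDensity_eq_integral_toReal_smul md
      (Eventually.of_forall fun q => ENNReal.ofReal_lt_top)]
    rw [hP, integral_withDensity_eq_integral_toReal_smul mw
      (Eventually.of_forall fun q => ENNReal.ofReal_lt_top)]
    have e1 : ∀ z : Ed d, (ENNReal.ofReal (c * wF z)).toReal • φ (x + Lmap v z) =
        c * (φ (x + Lmap v z) * wF z) := by
      intro z
      rw [ENNReal.toReal_ofReal (mul_nonneg hc0.le (wF_nonneg z)), smul_eq_mul]; ring
    have e2 : ∀ q : ℝ × Ed d, (ENNReal.ofReal (dens C q)).toReal •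
        ((1/2 : ℝ) * frob (hess φ (x + q.1 • Lmap v q.2)) (B.transpose * B)) =
        dens C q * ((1/2 : ℝ) * frob (hess φ (x + q.1 • Lmap v q.2)) (B.transpose * B)) := by
      intro q
      rw [ENNReal.toReal_ofReal (dens_nonneg hC0.le q), smul_eq_mul]
    simp_rw [e1, e2]
    rw [hN, integral_prod _ (int_prod_of ?_ ?_)]
    · have e3 : ∫ z, (φ (x + Lmap v z) - φ x) * wF z =
          (∫ z, φ (x + Lmap v z) * wF z) - φ x * ∫ z : Ed d, wF z := by
        rw [← integral_const_mul, ← integral_sub]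
        · simp_rw [sub_mul]
        · apply int_of
          · fun_prop
          · intro z hz; simp [wF_supp hz]
        · exact hwi.const_mul _
      have e4 : c * ∫ z, (φ (x + Lmap v z) - φ x) * wF z =
          c * (∫ z, φ (x + Lmap v z) * wF z) - φ x := by
        rw [e3, mul_sub, mul_left_comm, hcw, mul_one]
      rw [integral_const_mul, ← e4, hcore, ← integral_const_mul]
      refine setIntegral_congr_fun measurableSet_Ioc fun s hs => ?_
      simp only
      rw [← integral_const_mul]
      refine integral_congr_ae (Eventually.of_forall fun z => ?_)
      simp only [dens, frob_hess, abs_of_pos hs.1]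
      have : ∀ y, ∑ k, fderiv ℝ (fderiv ℝ φ) y (v k) (v k) =
          r ^ 2 * ∑ k, fderiv ℝ (fderiv ℝ φ) y (b k) (b k) := by
        intro y
        rw [Finset.mul_sum]
        refine Finset.sum_congr rfl fun k _ => ?_
        simp only [hv, map_smul, _root_.smul_apply, smul_eq_mul]
        ring
      rw [this, hC]
      ring
    · have := dens_cont (d := d) C
      exact this.mul (hHc.comp (by fun_prop))
    · intro s z hz
      simp [dens, hF_supp hz]

lemma frob_smul_left {d : ℕ} (t : ℝ) (A M : Matd d) : frob (t • A) M = t * frob A M := by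
  simp [frob, Finset.mul_sum, mul_assoc]

lemma psi_integrable {d : ℕ} {ψ : Ed d → ℝ} (hψ : IsC2c ψ) (p : Measure (Ed d))
    [IsFiniteMeasure p] : Integrable ψ p :=
  hψ.1.continuous.integrable_of_hasCompactSupport hψ.2

end Prop41

/-- Proposition 4.1. If `ψ ∈ C²_c(ℝ^d)` and `½∇²ψ(X) ⊆ dom(f⋆)`, then
`−ψ = (−ψ)^G` on `X`. Conversely, if `ψ ∈ C²_c(ℝ^d)` and `−ψ = (−ψ)^G` on `Ω`, then
`½∇²ψ(X) ⊆ dom(f⋆)`. -/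
theorem stmt11 {d : ℕ} (hd : 0 < d) (f : Matd d → ℝ≥0∞) (hA1 : CostA1 f) (hA2 : CostA2 f)
    (Ω X : Set (Ed d)) (hΩopen : IsOpen Ω) (hΩconv : Convex ℝ Ω)
    (hΩbdd : Bornology.IsBounded Ω) (hΩne : Ω.Nonempty) (hX : X = closure Ω)
    (ψ : Ed d → ℝ) (hψ : IsC2c ψ) :
    ((∀ x ∈ X, (1/2 : ℝ) • hess ψ x ∈ domFstar f) → GEq f X (fun y => -ψ y) X) ∧
    (GEq f X (fun y => -ψ y) Ω → ∀ x ∈ X, (1/2 : ℝ) • hess ψ x ∈ domFstar f) := by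
  classical
  have hXcl : IsClosed X := hX ▸ isClosed_closure
  have hΩX : Ω ⊆ X := hX ▸ subset_closure
  constructor
  · intro hdom x hx
    apply le_antisymm
    · apply sInf_le
      refine ⟨Measure.dirac x, inferInstance, ?_, ?_⟩
      · rw [Measure.dirac_apply' _ hXcl.measurableSet.compl]
        simp [hx]
      · have hG : Gcost f X x (Measure.dirac x) = 0 := by
          refine le_antisymm (sInf_le ⟨0, fun _ => 0, ⟨inferInstance, by simp, ?_, ?_⟩, by simp⟩)
            (zero_le)
          · intro _; exact Matrix.PosSemidef.zero
          · intro φ _; simp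
        rw [hG]; simp
    · apply le_sInf
      rintro _ ⟨p, hp, hpX, rfl⟩
      have hkey : ENNReal.ofReal (∫ y, ψ y ∂p - ψ x) ≤ Gcost f X x p := by
        apply le_sInf
        rintro _ ⟨m, ρ, ⟨hm, hmX, hρ, hφ⟩, rfl⟩
        have h1 := hφ ψ hψ
        rw [integral_dirac] at h1
        rw [← h1]
        have hae : ∀ᵐ y ∂m, y ∈ X := hmX
        have h2 : ∫⁻ y, ENNReal.ofReal ((1/2 : ℝ) * frob (hess ψ y) (ρ y)) ∂m ≤
            ∫⁻ y, f (ρ y) ∂m := by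
          apply lintegral_mono_ae
          filter_upwards [hae] with y hy
          by_cases hf : f (ρ y) = ⊤
          · rw [hf]; exact le_top
          · have := hdom y hy (ρ y) hf
            rwa [Prop41.frob_smul_left] at this
        refine le_trans ?_ h2
        by_cases hi : Integrable (fun y => (1/2 : ℝ) * frob (hess ψ y) (ρ y)) m
        · rw [integral_eq_lintegral_pos_part_sub_lintegral_neg_part hi]
          refine le_trans (ENNReal.ofReal_le_ofReal (sub_le_self _ ENNReal.toReal_nonneg)) ?_
          exact ENNReal.ofReal_toReal_le
        · rw [integral_undef hi]; simp
      rw [integral_neg]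
      have h3 : (((∫ y, ψ y ∂p - ψ x : ℝ)) : EReal) ≤ (Gcost f X x p : EReal) := by
        refine le_trans ?_ (EReal.coe_ennreal_le_coe_ennreal_iff.2 hkey)
        rw [EReal.coe_ennreal_ofReal]
        exact EReal.coe_le_coe_iff.2 (le_max_left _ _)
      calc ((-ψ x : ℝ) : EReal) = ((-∫ y, ψ y ∂p : ℝ) : EReal) + ((∫ y, ψ y ∂p - ψ x : ℝ) : EReal) := by
            rw [← EReal.coe_add]; congr 1; ring
        _ ≤ _ := by gcongr
  · intro hG x0 hx0
    by_contra hnot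
    simp only [domFstar, mem_setOf_eq, not_forall, not_le] at hnot
    obtain ⟨M, hfM, hlt⟩ := hnot
    rw [Prop41.frob_smul_left] at hlt
    have hPSD := hA1.1 M hfM
    obtain ⟨B, hB⟩ : ∃ B : Matd d, M = B.transpose * B := by
      open scoped MatrixOrder Matrix.Norms.L2Operator in
      obtain ⟨B, hB⟩ := CStarAlgebra.nonneg_iff_eq_star_mul_self.1 hPSD.nonneg
      exact ⟨B, by rw [hB, Matrix.star_eq_conjTranspose, Matrix.conjTranspose_eq_transpose_of_trivial]⟩
    have hlt' : (f M).toReal < (1/2 : ℝ) * frob (hess ψ x0) M :=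
      (ENNReal.lt_ofReal_iff_toReal_lt hfM).1 hlt
    obtain ⟨a, ha1, ha2⟩ := exists_between hlt'
    have hc := Prop41.hess_cont hψ.1 M
    have hopen : IsOpen {y | a < (1/2 : ℝ) * frob (hess ψ y) M} := isOpen_lt continuous_const hc
    rw [hX] at hx0
    obtain ⟨x, hxa, hxΩ⟩ := mem_closure_iff.1 hx0 _ hopen ha2
    obtain ⟨δ, hδ, hball⟩ := Metric.nhds_basis_closedBall.mem_iff.1
      ((hopen.inter hΩopen).mem_nhds ⟨hxa, hxΩ⟩)
    obtain ⟨p, m, hp, hpB, hm, hm0, hmB, hφ⟩ := Prop41.competitor x B hδ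
    rw [← hB] at hφ
    have hBX : Xᶜ ⊆ (Metric.closedBall x δ)ᶜ :=
      compl_subset_compl.2 fun y hy => hΩX (hball hy).2
    have hcost : Gcost f X x p ≤ f M * m univ := by
      refine sInf_le ⟨m, fun _ => M, ⟨hm, measure_mono_null hBX hmB, fun _ => hPSD, ?_⟩, by simp⟩
      intro φ hφ'
      rw [hφ φ hφ', integral_dirac]
    have hle : ((-ψ x : ℝ) : EReal) ≤ ((∫ y, -ψ y ∂p : ℝ) : EReal) + (Gcost f X x p : EReal) := by
      rw [← hG x hxΩ]
      exact sInf_le ⟨p, hp, measure_mono_null hBX hpB, rfl⟩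
    have hle2 : ((-ψ x : ℝ) : EReal) ≤
        ((∫ y, -ψ y ∂p : ℝ) : EReal) + (((f M * m univ).toReal : ℝ) : EReal) := by
      refine hle.trans ?_
      have : (((f M * m univ).toReal : ℝ) : EReal) = ((f M * m univ : ℝ≥0∞) : EReal) :=
        EReal.coe_ennreal_toReal (ENNReal.mul_ne_top hfM (measure_ne_top m _))
      rw [this]
      gcongr
      exact EReal.coe_ennreal_le_coe_ennreal_iff.2 hcost
    rw [← EReal.coe_add, EReal.coe_le_coe_iff, integral_neg, ENNReal.toReal_mul] at hle2
    have hψm := hφ ψ hψ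
    have hmpos : 0 < (m univ).toReal := ENNReal.toReal_pos hm0 (measure_ne_top m _)
    have hlow : a * (m univ).toReal ≤ ∫ y, (1/2 : ℝ) * frob (hess ψ y) M ∂m := by
      have hae : ∀ᵐ y ∂m, y ∈ Metric.closedBall x δ := hmB
      have hint : Integrable (fun y => (1/2 : ℝ) * frob (hess ψ y) M) m := by
        have h1 : IntegrableOn (fun y => (1/2 : ℝ) * frob (hess ψ y) M) (Metric.closedBall x δ) m :=
          hc.continuousOn.integrableOn_compact (isCompact_closedBall x δ)
        rwa [IntegrableOn, Measure.restrict_eq_self_of_ae_mem hae] at h1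
      calc a * (m univ).toReal = ∫ _, a ∂m := by simp [Measure.real, mul_comm]
        _ ≤ _ := by
          apply integral_mono_ae (integrable_const a) hint
          filter_upwards [hae] with y hy
          exact (hball hy).1.le
    nlinarith [mul_lt_mul_of_pos_right ha1 hmpos]
end
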